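/- For any canonical module ω_R of R, the endomorphism ring Hom_R(H^{n−1}_I(ω_R), H^{n−1}_I(ω_R)) is not finitely generated as an R-module. -/

import Mathlib

open CategoryTheory Opposite MvPowerSeries

set_option synthInstance.maxHeartbeats 1000000
set_option maxHeartbeats 1000000

noncomputable section

/-- The grade of an ideal: the maximal length of a regular sequence contained in it. -/
def idealGrade {A : Type} [CommRing A] (J : Ideal A) : ℕ∞ :=
  sSup {c : ℕ∞ | ∃ rs : List A, (∀ r ∈ rs, r ∈ J) ∧
    RingTheory.Sequence.IsRegular A rs ∧ (rs.length : ℕ∞) = c}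

/-- The height of an ideal: the infimum of heights of primes containing it. -/
def idealHeight {A : Type} [CommRing A] (J : Ideal A) : ℕ∞ :=
  sInf {h : ℕ∞ | ∃ p : PrimeSpectrum A, J ≤ p.asIdeal ∧ Order.height p = h}

/-- A canonical module of a `d`-dimensional local ring `A`: a finitely generated module `ω`
with `Ext_A^i(𝕜, ω) = 0` for `i ≠ d` and `Ext_A^d(𝕜, ω)` a one-dimensional `𝕜`-vector space
(equivalently, isomorphic to `𝕜` as an `A`-module), where `𝕜` is the residue field. -/
def IsCanonicalModule (A : Type) [CommRing A] [IsLocalRing A] (d : ℕ)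
    (ω : ModuleCat A) : Prop :=
  Module.Finite A ω ∧
  (∀ i : ℕ, i ≠ d → Subsingleton
    (((Ext A (ModuleCat A) i).obj
      (op (ModuleCat.of A (IsLocalRing.ResidueField A)))).obj ω)) ∧
  Nonempty ((((Ext A (ModuleCat A) d).obj
      (op (ModuleCat.of A (IsLocalRing.ResidueField A)))).obj ω)
    ≃ₗ[A] IsLocalRing.ResidueField A)

variable (𝕜 : Type) [Field 𝕜] (m n : ℕ)

/-- The formal power series ring `P` in the entries of an `m × n` matrix of variables. -/
abbrev DetP := MvPowerSeries (Fin m × Fin n) 𝕜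

/-- The ideal of `P` generated by the `2 × 2` minors of the matrix of variables. -/
def detI2 : Ideal (DetP 𝕜 m n) :=
  Ideal.span {f | ∃ (i k : Fin m) (j l : Fin n), i < k ∧ j < l ∧
    f = X (i, j) * X (k, l) - X (i, l) * X (k, j)}

/-- The complete determinantal ring `R = P/I₂(X)`. -/
abbrev DetR := DetP 𝕜 m n ⧸ detI2 𝕜 m n

/-- The residue class in `R` of the variable `x_{ij}`. -/
def detx (i : Fin m) (j : Fin n) : DetR 𝕜 m n :=
  Ideal.Quotient.mk (detI2 𝕜 m n) (X (i, j))

/-- The ideal `I` of `R` generated by the entries of the first `n - 1` columns. -/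
def detJ : Ideal (DetR 𝕜 m n) :=
  Ideal.span {x | ∃ (i : Fin m) (j : Fin n), (j : ℕ) < n - 1 ∧ x = detx 𝕜 m n i j}

/-- The formal power series ring `S = 𝕜[[x_1, …, x_m, a_1, …, a_{n-1}]]`. -/
abbrev DetS := MvPowerSeries (Fin m ⊕ Fin (n - 1)) 𝕜

/-- The ideal `𝔞 = (a_1, …, a_{n-1})S`. -/
def detA : Ideal (DetS 𝕜 m n) :=
  Ideal.span {f | ∃ j : Fin (n - 1), f = X (Sum.inr j)}

/-- The property pinning down the local `𝕜`-algebra homomorphism `φ : R → S`: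
`x_{ij} ↦ a_j·x_i` for `1 ≤ j ≤ n-1` and `x_{in} ↦ x_i` (in `0`-based indexing, the last
column is `j = n-1`).  Any `𝕜`-algebra homomorphism `R → S` with these values on the
variables automatically maps the maximal ideal into the maximal ideal, hence is continuous
and is uniquely determined by these values; so this predicate characterizes `φ`. -/
def IsDetPhi (φ : DetR 𝕜 m n →ₐ[𝕜] DetS 𝕜 m n) : Prop :=
  ∀ (i : Fin m) (j : Fin n),
    φ (detx 𝕜 m n i j) =
      if h : (j : ℕ) < n - 1 then X (Sum.inr (⟨j, h⟩ : Fin (n - 1))) * X (Sum.inl i)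
      else X (Sum.inl i)

namespace ExtComparison

open CategoryTheory.Abelian

lemma exists_linearEquiv_of_ker_eq {R A B C : Type*} [CommRing R] [AddCommGroup A] [Module R A]
    [AddCommGroup B] [Module R B] [AddCommGroup C] [Module R C] (r : A →ₗ[R] B) (g : A →ₗ[R] C)
    (hr : Function.Surjective r) (hg : Function.Surjective g)
    (h : LinearMap.ker r = LinearMap.ker g) :
    ∃ e : B ≃ₗ[R] C, ∀ a, e (r a) = g a := by
  refine ⟨(r.quotKerEquivOfSurjective hr).symm ≪≫ₗ Submodule.quotEquivOfEq _ _ h ≪≫ₗ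
    g.quotKerEquivOfSurjective hg, fun a => ?_⟩
  have : (r.quotKerEquivOfSurjective hr).symm (r a) = Submodule.Quotient.mk a := by
    rw [LinearEquiv.symm_apply_eq]; rfl
  rw [LinearEquiv.trans_apply, LinearEquiv.trans_apply, this]
  rfl

variable {R : Type} [CommRing R] {X X' : ModuleCat.{0} R} (P : ProjectiveResolution X)
  (P' : ProjectiveResolution X') (Y : ModuleCat.{0} R) (p : ℕ)

/-- The complex in the opposite category computing the derived functor defining `Ext`. -/
abbrev homComplex : ChainComplex (ModuleCat.{0} R)ᵒᵖ ℕ :=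
  (((linearYoneda R (ModuleCat.{0} R)).obj Y).rightOp.mapHomologicalComplex _).obj P.complex

/-- The derived functor defining `Ext`, computed by a projective resolution. -/
def leftDerivedIso : (((linearYoneda R (ModuleCat.{0} R)).obj Y).rightOp.leftDerived (p + 1)).obj X
    ≅ (homComplex P Y).homology (p + 1) :=
  P.isoLeftDerivedObj ((linearYoneda R (ModuleCat.{0} R)).obj Y).rightOp (p + 1)

/-- Cocycles surject onto `Ext`. -/
def toOldExt : ((homComplex P Y).opcycles (p + 1)).unop ⟶
    ((Ext R (ModuleCat.{0} R) (p + 1)).obj (op X)).obj Y :=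
  ((leftDerivedIso P Y p).hom ≫ (homComplex P Y).homologyι (p + 1)).unop

/-- The inclusion of cocycles in cochains. -/
def cocycleHom : ((homComplex P Y).opcycles (p + 1)).unop ⟶
    ModuleCat.of R (P.complex.X (p + 1) ⟶ Y) :=
  ((homComplex P Y).pOpcycles (p + 1)).unop

/-- The differential as a map to cocycles. -/
def toCocycle : ModuleCat.of R (P.complex.X p ⟶ Y) ⟶
    ((homComplex P Y).opcycles (p + 1)).unop :=
  ((homComplex P Y).fromOpcycles (p + 1) p).unop

lemma unop_exact_iff {A B C : (ModuleCat.{0} R)ᵒᵖ} (f : A ⟶ B) (g : B ⟶ C) (w : f ≫ g = 0)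
    (h : (ShortComplex.mk f g w).Exact) (b : B.unop) :
    f.unop b = 0 ↔ ∃ c, g.unop c = b := by
  have h2 := h.unop
  rw [ShortComplex.moduleCat_exact_iff] at h2
  refine ⟨h2 b, ?_⟩
  rintro ⟨c, rfl⟩
  exact congr($(congrArg Quiver.Hom.unop w) c)

lemma toOldExt_surjective : Function.Surjective (toOldExt P Y p) := by
  have : Epi (toOldExt P Y p) := by
    unfold toOldExt
    exact unop_epi_of_mono _
  exact (ModuleCat.epi_iff_surjective _).1 this

lemma cocycleHom_injective : Function.Injective (cocycleHom P Y p) := by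
  have : Mono (cocycleHom P Y p) := by
    unfold cocycleHom
    exact unop_mono_of_epi _
  exact (ModuleCat.mono_iff_injective _).1 this

lemma cocycleHom_toCocycle (g : P.complex.X p ⟶ Y) :
    cocycleHom P Y p (toCocycle P Y p g) = P.complex.d (p + 1) p ≫ g := by
  have := (homComplex P Y).p_fromOpcycles (p + 1) p
  exact congr($(congrArg Quiver.Hom.unop this) g)

lemma toOldExt_eq_zero_iff (a) : toOldExt P Y p a = 0 ↔ ∃ g, toCocycle P Y p g = a := by
  let i := (leftDerivedIso P Y p).unop
  have h3 : ∀ a, toOldExt P Y p a = i.hom (((homComplex P Y).homologyι (p + 1)).unop a) :=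
    fun a => rfl
  have hi : Function.Injective i.hom := (ModuleCat.mono_iff_injective _).1 inferInstance
  refine Iff.trans (show _ ↔ ((homComplex P Y).homologyι (p + 1)).unop a = 0 from
    ⟨fun h => hi (((h3 a).symm.trans h).trans (map_zero i.hom.hom).symm),
      fun h => (h3 a).trans ((congrArg i.hom h).trans (map_zero i.hom.hom))⟩) ?_
  exact unop_exact_iff _ _ ((homComplex P Y).homologyι_comp_fromOpcycles _ _)
    (ShortComplex.exact_of_f_is_kernel _ ((homComplex P Y).homologyIsKernel (p + 1) p (by simp))) a

lemma mem_range_cocycleHom_iff (f : P.complex.X (p + 1) ⟶ Y) :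
    (∃ a, cocycleHom P Y p a = f) ↔ P.complex.d (p + 2) (p + 1) ≫ f = 0 :=
  (unop_exact_iff _ _ ((homComplex P Y).d_pOpcycles (p + 2) (p + 1))
    (ShortComplex.exact_of_g_is_cokernel _
      ((homComplex P Y).opcyclesIsCokernel _ _ (by simp))) f).symm

/-- Cocycles map to `Abelian.Ext`. -/
def toNewExt : ((homComplex P Y).opcycles (p + 1)).unop →ₗ[R] Abelian.Ext X Y (p + 1) where
  toFun a := P.extMk (cocycleHom P Y p a) (p + 2) rfl
    ((mem_range_cocycleHom_iff P Y p _).1 ⟨a, rfl⟩)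
  map_add' a b := by
    rw [P.add_extMk]
    congr 1
    exact map_add (cocycleHom P Y p).hom a b
  map_smul' r a := by
    rw [RingHom.id_apply, Abelian.Ext.smul_eq_comp_mk₀, P.extMk_comp_mk₀]
    congr 1
    rw [Linear.comp_smul, Category.comp_id]
    exact map_smul (cocycleHom P Y p).hom r a

lemma toNewExt_surjective : Function.Surjective (toNewExt P Y p) := by
  intro z
  obtain ⟨f, hf, rfl⟩ := P.extMk_surjective z (p + 2) rfl
  obtain ⟨a, rfl⟩ := (mem_range_cocycleHom_iff P Y p f).2 hf
  exact ⟨a, rfl⟩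

lemma ker_toOldExt_eq :
    LinearMap.ker (toOldExt P Y p).hom = LinearMap.ker (toNewExt P Y p) := by
  ext a
  rw [LinearMap.mem_ker, LinearMap.mem_ker]
  refine (toOldExt_eq_zero_iff P Y p a).trans (Iff.trans ?_
    (P.extMk_eq_zero_iff _ (p + 2) rfl ((mem_range_cocycleHom_iff P Y p _).1 ⟨a, rfl⟩)
      p rfl).symm)
  refine exists_congr fun g => ?_
  rw [← cocycleHom_toCocycle]
  exact (cocycleHom_injective P Y p).eq_iff.symm

variable (X) in
/-- The comparison of the two `Ext` modules in positive degree. -/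
def comparison : ((Ext R (ModuleCat.{0} R) (p + 1)).obj (op X)).obj Y ≃ₗ[R]
    Abelian.Ext X Y (p + 1) :=
  (exists_linearEquiv_of_ker_eq (toOldExt (projectiveResolution X) Y p).hom
    (toNewExt (projectiveResolution X) Y p) (toOldExt_surjective _ Y p)
    (toNewExt_surjective _ Y p) (ker_toOldExt_eq _ Y p)).choose

lemma comparison_toOldExt (a) : comparison X Y p (toOldExt (projectiveResolution X) Y p a) =
    toNewExt (projectiveResolution X) Y p a :=
  (exists_linearEquiv_of_ker_eq (toOldExt (projectiveResolution X) Y p).hom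
    (toNewExt (projectiveResolution X) Y p) (toOldExt_surjective _ Y p)
    (toNewExt_surjective _ Y p) (ker_toOldExt_eq _ Y p)).choose_spec a

lemma comparison_naturality (f : X' ⟶ X)
    (z : ((Ext R (ModuleCat.{0} R) (p + 1)).obj (op X)).obj Y) :
    comparison X' Y p (((Ext R (ModuleCat.{0} R) (p + 1)).map f.op).app Y z) =
      (Abelian.Ext.mk₀ f).comp (comparison X Y p z) (zero_add _) := by
  obtain ⟨a, rfl⟩ := toOldExt_surjective (projectiveResolution X) Y p z
  let P := projectiveResolution X
  let P' := projectiveResolution X'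
  let φ : P'.complex ⟶ P.complex := ProjectiveResolution.lift f P' P
  have hφ0 : φ.f 0 ≫ P.π.f 0 = P'.π.f 0 ≫ f :=
    ProjectiveResolution.lift_commutes_zero f P' P
  let F := ((linearYoneda R (ModuleCat.{0} R)).obj Y).rightOp
  let ψ : homComplex P' Y ⟶ homComplex P Y := (F.mapHomologicalComplex _).map φ
  have h1 : (F.leftDerived (p + 1)).map f ≫ (leftDerivedIso P Y p).hom =
      (leftDerivedIso P' Y p).hom ≫ HomologicalComplex.homologyMap ψ (p + 1) :=
    ProjectiveResolution.isoLeftDerivedObj_hom_naturality f P' P φ hφ0 F (p + 1)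
  have h2 := HomologicalComplex.homologyι_naturality ψ (p + 1)
  have h3 := HomologicalComplex.p_opcyclesMap ψ (p + 1)
  have key : ((Ext R (ModuleCat.{0} R) (p + 1)).map f.op).app Y (toOldExt P Y p a) =
      toOldExt P' Y p ((HomologicalComplex.opcyclesMap ψ (p + 1)).unop a) := by
    have : (F.leftDerived (p + 1)).map f ≫ (leftDerivedIso P Y p).hom ≫
        (homComplex P Y).homologyι (p + 1) =
        ((leftDerivedIso P' Y p).hom ≫ (homComplex P' Y).homologyι (p + 1)) ≫
        HomologicalComplex.opcyclesMap ψ (p + 1) := by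
      rw [← Category.assoc, h1, Category.assoc, Category.assoc, ← h2]
    exact congr($(congrArg Quiver.Hom.unop this) a)
  erw [key, comparison_toOldExt, comparison_toOldExt]
  let Φ : ProjectiveResolution.Hom P' P f :=
    { hom := φ, hom_f_zero_comp_π_f_zero := hφ0.trans (by simp) }
  refine Eq.trans ?_ (ProjectiveResolution.mk₀_comp_extMk (cocycleHom P Y p a) (p + 2) rfl
    ((mem_range_cocycleHom_iff P Y p _).1 ⟨a, rfl⟩) Φ).symm
  change P'.extMk _ (p + 2) rfl ((mem_range_cocycleHom_iff P' Y p _).1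
    ⟨(HomologicalComplex.opcyclesMap ψ (p + 1)).unop a, rfl⟩) = _
  congr 1
  exact congr($(congrArg Quiver.Hom.unop h3) a)

end ExtComparison

namespace ExtComparison

open CategoryTheory.Abelian CategoryTheory.Limits

variable {R : Type} [CommRing R] (J : Ideal R) (Y : ModuleCat.{0} R) (p : ℕ)

/-- The pull-back on `Ext` along a linear map. -/
def extPre {N N' : Type} [AddCommGroup N] [Module R N] [AddCommGroup N'] [Module R N']
    (f : N →ₗ[R] N') (j : ℕ) :
    Abelian.Ext (ModuleCat.of R N') Y j →ₗ[R] Abelian.Ext (ModuleCat.of R N) Y j :=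
  (Abelian.Ext.mk₀ (ModuleCat.ofHom f)).precompOfLinear R Y (zero_add j)

lemma extPre_apply {N N' : Type} [AddCommGroup N] [Module R N] [AddCommGroup N'] [Module R N']
    (f : N →ₗ[R] N') (j : ℕ) (z) :
    extPre Y f j z = (Abelian.Ext.mk₀ (ModuleCat.ofHom f)).comp z (zero_add j) := rfl

/-- The transition map of the quotients by powers. -/
def powTrans {t t' : ℕ} (h : t ≤ t') : (R ⧸ J ^ t') →ₗ[R] (R ⧸ J ^ t) :=
  Submodule.mapQ _ _ LinearMap.id (Ideal.pow_le_pow_right h)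

/-- The diagram whose colimit is local cohomology. -/
abbrev lcDiagram : (ℕᵒᵖ)ᵒᵖ ⥤ ModuleCat.{0} R :=
  localCohomology.diagram (localCohomology.idealPowersDiagram J) (p + 1) ⋙ (evaluation _ _).obj Y

/-- The colimit cocone of local cohomology. -/
def lcCocone : Cocone (lcDiagram J Y p) :=
  ((evaluation _ _).obj Y).mapCocone
    (colimit.cocone (localCohomology.diagram (localCohomology.idealPowersDiagram J) (p + 1)))

/-- Local cohomology is a colimit. -/
def lcIsColimit : IsColimit (lcCocone J Y p) :=
  isColimitOfPreserves _ (colimit.isColimit _)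

/-- The comparison in each degree of the diagram. -/
def lcComparison (t : ℕ) : (lcDiagram J Y p).obj (op (op t)) ≃ₗ[R]
    Abelian.Ext (ModuleCat.of R (R ⧸ J ^ t)) Y (p + 1) :=
  comparison (ModuleCat.of R (R ⧸ J ^ t)) Y p

lemma lcComparison_naturality {t t' : ℕ} (h : t ≤ t') (z) :
    lcComparison J Y p t' ((lcDiagram J Y p).map (homOfLE h).op.op z) =
      extPre Y (powTrans J h) (p + 1) (lcComparison J Y p t z) :=
  comparison_naturality Y p (ModuleCat.ofHom (powTrans J h)) z

/-- The structure maps to local cohomology. -/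
def lcι (t : ℕ) : Abelian.Ext (ModuleCat.of R (R ⧸ J ^ t)) Y (p + 1) →ₗ[R]
    (localCohomology J (p + 1)).obj Y :=
  ((lcCocone J Y p).ι.app (op (op t))).hom ∘ₗ (lcComparison J Y p t).symm.toLinearMap

lemma lcι_comparison (t : ℕ) (z) : lcι J Y p t (lcComparison J Y p t z) =
    (lcCocone J Y p).ι.app (op (op t)) z :=
  congrArg ((lcCocone J Y p).ι.app (op (op t))).hom ((lcComparison J Y p t).symm_apply_apply z)

lemma lcι_extPre {t t' : ℕ} (h : t ≤ t') (z) :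
    lcι J Y p t' (extPre Y (powTrans J h) (p + 1) z) = lcι J Y p t z := by
  obtain ⟨z, rfl⟩ := (lcComparison J Y p t).surjective z
  rw [← lcComparison_naturality, lcι_comparison, lcι_comparison]
  exact congr($((lcCocone J Y p).w (homOfLE h).op.op) z)

lemma exists_extPre_eq_zero {t : ℕ} (z) (hz : lcι J Y p t z = 0) :
    ∃ (t' : ℕ) (h : t ≤ t'), extPre Y (powTrans J h) (p + 1) z = 0 := by
  obtain ⟨z, rfl⟩ := (lcComparison J Y p t).surjective z
  rw [lcι_comparison] at hz
  obtain ⟨k, f, g, hfg⟩ := Concrete.isColimit_exists_of_rep_eq (lcDiagram J Y p)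
    (lcIsColimit J Y p) (i := op (op t)) (j := op (op t)) z 0
    (hz.trans (map_zero ((lcCocone J Y p).ι.app (op (op t))).hom).symm)
  obtain ⟨t', ht', rfl⟩ : ∃ (t' : ℕ) (h : t ≤ t'), k = op (op t') :=
    ⟨k.unop.unop, f.unop.unop.down.down, rfl⟩
  refine ⟨t', ht', ?_⟩
  rw [← lcComparison_naturality]
  refine (congrArg _ ?_).trans (map_zero (lcComparison J Y p t'))
  exact hfg.trans (map_zero ((lcDiagram J Y p).map g).hom)

lemma exists_end_of_compatible
    (β : ∀ t, Module.End R (Abelian.Ext (ModuleCat.of R (R ⧸ J ^ t)) Y (p + 1)))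
    (hβ : ∀ {t t' : ℕ} (h : t ≤ t') z, β t' (extPre Y (powTrans J h) (p + 1) z) =
      extPre Y (powTrans J h) (p + 1) (β t z)) :
    ∃ B : Module.End R ((localCohomology J (p + 1)).obj Y),
      ∀ t z, B (lcι J Y p t z) = lcι J Y p t (β t z) := by
  let c : Cocone (lcDiagram J Y p) :=
    { pt := (localCohomology J (p + 1)).obj Y
      ι :=
        { app := fun t => ModuleCat.ofHom (lcι J Y p t.unop.unop ∘ₗ β t.unop.unop ∘ₗ
            (lcComparison J Y p t.unop.unop).toLinearMap)
          naturality := by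
            intro t t' f
            ext z
            change lcι J Y p _ (β _ (lcComparison J Y p _ ((lcDiagram J Y p).map f z))) =
              lcι J Y p _ (β _ (lcComparison J Y p _ z))
            have := lcComparison_naturality J Y p (t := t.unop.unop) (t' := t'.unop.unop)
              f.unop.unop.down.down z
            erw [this]
            rw [hβ, lcι_extPre] } }
  refine ⟨((lcIsColimit J Y p).desc c).hom, fun t z => ?_⟩
  obtain ⟨z, rfl⟩ := (lcComparison J Y p t).surjective z
  rw [lcι_comparison]
  exact congr($((lcIsColimit J Y p).fac c (op (op t))) z)

end ExtComparison

namespace ExtComparison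

open CategoryTheory.Abelian

variable {R : Type} [CommRing R] (Y : ModuleCat.{0} R)
  {A B C A' B' C' : Type} [AddCommGroup A] [Module R A] [AddCommGroup B] [Module R B]
  [AddCommGroup C] [Module R C] [AddCommGroup A'] [Module R A'] [AddCommGroup B'] [Module R B']
  [AddCommGroup C'] [Module R C']

lemma extPre_comp (f : A →ₗ[R] B) (g : B →ₗ[R] C) (j : ℕ) (z) :
    extPre Y (g ∘ₗ f) j z = extPre Y f j (extPre Y g j z) := by
  simp [extPre_apply]

lemma extPre_id (j : ℕ) (z) : extPre Y (LinearMap.id : A →ₗ[R] A) j z = z := by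
  simp [extPre_apply]

lemma extPre_zero (j : ℕ) (z) : extPre Y (0 : A →ₗ[R] B) j z = 0 := by
  simp [extPre_apply]

lemma extPre_add (f g : A →ₗ[R] B) (j : ℕ) (z) :
    extPre Y (f + g) j z = extPre Y f j z + extPre Y g j z := by
  simp only [extPre_apply, ModuleCat.ofHom_add, Abelian.Ext.mk₀_add, Abelian.Ext.add_comp]

lemma extPre_smul (r : R) (f : A →ₗ[R] B) (j : ℕ) (z) :
    extPre Y (r • f) j z = r • extPre Y f j z := by
  have : ModuleCat.ofHom (r • f) = r • ModuleCat.ofHom f := rfl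
  simp only [extPre_apply, this, Abelian.Ext.mk₀_smul, Abelian.Ext.smul_comp]

lemma extPre_bijective_of_equiv (e : A ≃ₗ[R] B) (j : ℕ) :
    Function.Bijective (extPre Y e.toLinearMap j) := by
  refine Function.bijective_iff_has_inverse.2 ⟨extPre Y e.symm.toLinearMap j, fun z => ?_,
    fun z => ?_⟩
  · rw [← extPre_comp, LinearEquiv.comp_symm, extPre_id]
  · rw [← extPre_comp, LinearEquiv.symm_comp, extPre_id]

/-- Short exactness of a pair of linear maps. -/
structure IsSES (f : A →ₗ[R] B) (g : B →ₗ[R] C) : Prop where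
  inj : Function.Injective f
  surj : Function.Surjective g
  exact : Function.Exact f g

namespace IsSES

lemma comp_eq_zero {f : A →ₗ[R] B} {g : B →ₗ[R] C} (h : IsSES f g) : g ∘ₗ f = 0 :=
  LinearMap.ext fun x => h.exact.apply_apply_eq_zero x

lemma of_surjective {g : B →ₗ[R] C} (h : Function.Surjective g) :
    IsSES (LinearMap.ker g).subtype g :=
  ⟨Subtype.val_injective, h, fun x => by simp⟩

lemma of_injective {f : A →ₗ[R] B} (h : Function.Injective f) :
    IsSES f (LinearMap.range f).mkQ :=
  ⟨h, Submodule.mkQ_surjective _, fun x => by simp⟩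

variable {f : A →ₗ[R] B} {g : B →ₗ[R] C} (h : IsSES f g)

/-- The associated short complex. -/
abbrev shortComplex : ShortComplex (ModuleCat.{0} R) :=
  ModuleCat.shortComplexOfCompEqZero f g h.comp_eq_zero

lemma shortExact : h.shortComplex.ShortExact :=
  ModuleCat.shortComplex_shortExact _ h.exact h.inj h.surj

/-- The connecting homomorphism. -/
def δ (j : ℕ) : Abelian.Ext (ModuleCat.of R A) Y j →ₗ[R]
    Abelian.Ext (ModuleCat.of R C) Y (j + 1) :=
  h.shortExact.extClass.precompOfLinear R Y (Nat.add_comm 1 j)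

variable {f' : A' →ₗ[R] B'} {g' : B' →ₗ[R] C'} (h' : IsSES f' g')

lemma exact₁ (j : ℕ) (z) (hz : h.δ Y j z = 0) : ∃ w, extPre Y f j w = z :=
  Abelian.Ext.contravariant_sequence_exact₁ h.shortExact Y z (Nat.add_comm 1 j) hz

include h in
lemma exact₂ (j : ℕ) (z) (hz : extPre Y f j z = 0) : ∃ w, extPre Y g j w = z :=
  Abelian.Ext.contravariant_sequence_exact₂ h.shortExact Y z hz

lemma exact₃ (j : ℕ) (z) (hz : extPre Y g (j + 1) z = 0) : ∃ w, h.δ Y j w = z :=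
  Abelian.Ext.contravariant_sequence_exact₃ h.shortExact Y z hz (Nat.add_comm 1 j)

lemma δ_naturality (α : A →ₗ[R] A') (β : B →ₗ[R] B') (γ : C →ₗ[R] C')
    (h₁ : β ∘ₗ f = f' ∘ₗ α) (h₂ : γ ∘ₗ g = g' ∘ₗ β) (j : ℕ) (z) :
    h.δ Y j (extPre Y α j z) = extPre Y γ (j + 1) (h'.δ Y j z) := by
  let φ : h.shortComplex ⟶ h'.shortComplex :=
    { τ₁ := ModuleCat.ofHom α
      τ₂ := ModuleCat.ofHom β
      τ₃ := ModuleCat.ofHom γ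
      comm₁₂ := by
        change ModuleCat.ofHom (f' ∘ₗ α) = ModuleCat.ofHom (β ∘ₗ f)
        rw [h₁]
      comm₂₃ := by
        change ModuleCat.ofHom (g' ∘ₗ β) = ModuleCat.ofHom (γ ∘ₗ g)
        rw [h₂] }
  have := ShortComplex.ShortExact.extClass_naturality h.shortExact h'.shortExact φ
  have e1 := Abelian.Ext.comp_assoc h.shortExact.extClass (Abelian.Ext.mk₀ φ.τ₁) z (add_zero 1)
    (zero_add j) (a := j + 1) (by omega)
  have e2 := Abelian.Ext.comp_assoc (Abelian.Ext.mk₀ φ.τ₃) h'.shortExact.extClass z (zero_add 1)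
    (Nat.add_comm 1 j) (a := j + 1) (by omega)
  rw [this] at e1
  exact e1.symm.trans e2

include h in
lemma subsingleton_mid (j : ℕ) (hA : Subsingleton (Abelian.Ext (ModuleCat.of R A) Y j))
    (hC : Subsingleton (Abelian.Ext (ModuleCat.of R C) Y j)) :
    Subsingleton (Abelian.Ext (ModuleCat.of R B) Y j) := by
  refine subsingleton_of_forall_eq 0 fun z => ?_
  obtain ⟨w, rfl⟩ := h.exact₂ Y j z (Subsingleton.elim _ _)
  rw [Subsingleton.elim w 0, map_zero]

include h in
lemma extPre_injective (j : ℕ) (hA : Subsingleton (Abelian.Ext (ModuleCat.of R A) Y j)) :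
    Function.Injective (extPre Y g (j + 1)) := by
  rw [injective_iff_map_eq_zero]
  intro z hz
  obtain ⟨w, rfl⟩ := h.exact₃ Y j z hz
  rw [Subsingleton.elim w 0, map_zero]

include h in
lemma extPre_surjective (j : ℕ) (hC : Subsingleton (Abelian.Ext (ModuleCat.of R C) Y (j + 1))) :
    Function.Surjective (extPre Y f j) := fun z =>
  h.exact₁ Y j z (Subsingleton.elim _ _)

include h in
lemma extPre_left_injective (j : ℕ) (hC : Subsingleton (Abelian.Ext (ModuleCat.of R C) Y j)) :
    Function.Injective (extPre Y f j) := by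
  rw [injective_iff_map_eq_zero]
  intro z hz
  obtain ⟨w, rfl⟩ := h.exact₂ Y j z hz
  rw [Subsingleton.elim w 0, map_zero]

lemma δ_surjective (j : ℕ) (hB : Subsingleton (Abelian.Ext (ModuleCat.of R B) Y (j + 1))) :
    Function.Surjective (h.δ Y j) := fun z => h.exact₃ Y j z (Subsingleton.elim _ _)

end IsSES

end ExtComparison

namespace ExtComparison

open CategoryTheory.Abelian

/-- The properties of a canonical module in positive degrees, in terms of `Abelian.Ext`. -/
structure CanonicalLike (R : Type) [CommRing R] [IsLocalRing R] (Y : ModuleCat.{0} R) (e : ℕ) :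
    Prop where
  finite : Module.Finite R Y
  subsingleton : ∀ j, 1 ≤ j → j ≠ e + 1 →
    Subsingleton (Abelian.Ext (ModuleCat.of R (IsLocalRing.ResidueField R)) Y j)
  nontrivial : Nontrivial (Abelian.Ext (ModuleCat.of R (IsLocalRing.ResidueField R)) Y (e + 1))

/-- Finitely generated modules killed by a power of the maximal ideal. -/
def FinLen (R : Type) [CommRing R] [IsLocalRing R] (N : Type) [AddCommGroup N] [Module R N] :
    Prop :=
  Module.Finite R N ∧ ∃ s, ∀ r ∈ IsLocalRing.maximalIdeal R ^ s, ∀ x : N, r • x = 0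

variable {R : Type} [CommRing R] [IsLocalRing R]
  {N N' : Type} [AddCommGroup N] [Module R N] [AddCommGroup N'] [Module R N']

lemma FinLen.of_surjective (h : FinLen R N) (f : N →ₗ[R] N') (hf : Function.Surjective f) :
    FinLen R N' := by
  obtain ⟨h1, s, hs⟩ := h
  refine ⟨Module.Finite.of_surjective f hf, s, fun r hr x => ?_⟩
  obtain ⟨x, rfl⟩ := hf x
  rw [← map_smul, hs r hr, map_zero]

lemma FinLen.of_injective [IsNoetherianRing R] (h : FinLen R N) (f : N' →ₗ[R] N)
    (hf : Function.Injective f) : FinLen R N' := by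
  obtain ⟨h1, s, hs⟩ := h
  refine ⟨Module.Finite.of_injective f hf, s, fun r hr x => hf ?_⟩
  rw [map_smul, hs r hr, map_zero]

variable [IsNoetherianRing R] {Y : ModuleCat.{0} R} {e : ℕ}

lemma CanonicalLike.subsingleton_of_finLen (hY : CanonicalLike R Y e) (hN : FinLen R N) (j : ℕ)
    (hj : 1 ≤ j) (hje : j ≠ e + 1) : Subsingleton (Abelian.Ext (ModuleCat.of R N) Y j) := by
  obtain ⟨h1, hs⟩ := hN
  revert hs
  induction h1 using IsNoetherianRing.induction_on_isQuotientEquivQuotientPrime R with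
  | subsingleton N =>
    intro _
    refine subsingleton_of_forall_eq 0 fun z => ?_
    rw [← extPre_id Y j z, Subsingleton.elim (LinearMap.id : N →ₗ[R] N) 0, extPre_zero]
  | quotient N p f =>
    rintro ⟨s, hs⟩
    have hp : IsLocalRing.maximalIdeal R = p.1 := by
      refine (IsLocalRing.maximalIdeal.isMaximal R).eq_of_le p.2.ne_top ?_
      refine p.2.le_of_pow_le (n := s) fun r hr => ?_
      have := hs r hr (f.symm 1)
      rw [← map_smul, map_eq_zero_iff _ f.symm.injective] at this
      rw [← Ideal.Quotient.eq_zero_iff_mem]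
      simpa [Algebra.smul_def] using this
    have f' : N ≃ₗ[R] IsLocalRing.ResidueField R :=
      f ≪≫ₗ Submodule.quotEquivOfEq _ _ hp.symm
    have := hY.subsingleton j hj hje
    exact (extPre_bijective_of_equiv Y f'.symm j).1.subsingleton
  | exact N₁ N₂ N₃ f g hf hg hfg h₁ h₃ =>
    rintro ⟨s, hs⟩
    refine IsSES.subsingleton_mid Y ⟨hf, hg, hfg⟩ j (h₁ ⟨s, ?_⟩) (h₃ ⟨s, ?_⟩)
    · intro r hr x
      exact hf (by rw [map_smul, hs r hr, map_zero])
    · intro r hr x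
      obtain ⟨x, rfl⟩ := hg x
      rw [← map_smul, hs r hr, map_zero]

lemma CanonicalLike.extPre_injective_of_finLen (hY : CanonicalLike R Y e) (he : 1 ≤ e)
    (hN : FinLen R N) (g : N →ₗ[R] N') (hg : Function.Surjective g) :
    Function.Injective (extPre Y g (e + 1)) :=
  IsSES.extPre_injective Y (IsSES.of_surjective hg) e
    (hY.subsingleton_of_finLen
      (hN.of_injective (LinearMap.ker g).subtype Subtype.val_injective) e he (by omega))

lemma CanonicalLike.nontrivial_of_finLen (hY : CanonicalLike R Y e) (he : 1 ≤ e)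
    (hN : FinLen R N) [Nontrivial N] : Nontrivial (Abelian.Ext (ModuleCat.of R N) Y (e + 1)) := by
  have := hN.1
  obtain ⟨K, hK, -⟩ := (eq_top_or_exists_le_coatom (⊥ : Submodule R N)).resolve_left bot_ne_top
  have hS : IsSimpleModule R (N ⧸ K) := isSimpleModule_iff_isCoatom.2 hK
  obtain ⟨I, hI, ⟨f⟩⟩ := isSimpleModule_iff_quot_maximal.1 hS
  obtain rfl := IsLocalRing.eq_maximalIdeal hI
  have f' : (N ⧸ K) ≃ₗ[R] IsLocalRing.ResidueField R := f
  have h := hY.nontrivial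
  have h' := hY.extPre_injective_of_finLen he hN (f'.toLinearMap ∘ₗ K.mkQ)
    (f'.surjective.comp K.mkQ_surjective)
  exact @Function.Injective.nontrivial _ _ h _ h'

lemma CanonicalLike.exists_extPre_ne_zero (hY : CanonicalLike R Y e) (he : 1 ≤ e)
    (hN : FinLen R N) (s : N →ₗ[R] N) (hs : s ≠ 0) :
    ∃ w : Abelian.Ext (ModuleCat.of R N) Y (e + 1), ∀ (N₁ : Type) [AddCommGroup N₁] [Module R N₁]
      (_ : FinLen R N₁) (p : N₁ →ₗ[R] N) (_ : Function.Surjective p),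
      extPre Y (s ∘ₗ p) (e + 1) w ≠ 0 := by
  have hL : FinLen R (LinearMap.range s) := 
    hN.of_injective (LinearMap.range s).subtype Subtype.val_injective
  have : Nontrivial (LinearMap.range s) := by
    rw [Submodule.nontrivial_iff_ne_bot]
    exact fun h => hs (LinearMap.range_eq_bot.1 h)
  have := hY.nontrivial_of_finLen he hL
  obtain ⟨u, hu⟩ := exists_ne (0 : Abelian.Ext (ModuleCat.of R (LinearMap.range s)) Y (e + 1))
  obtain ⟨w, rfl⟩ := IsSES.extPre_surjective Y
    (IsSES.of_injective (f := (LinearMap.range s).subtype) Subtype.val_injective) (e + 1)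
    (hY.subsingleton_of_finLen (hN.of_surjective _ (Submodule.mkQ_surjective _)) _
      (by omega) (by omega)) u
  refine ⟨w, fun N₁ _ _ hN₁ p hp h0 => hu ?_⟩
  refine (injective_iff_map_eq_zero _).1 (hY.extPre_injective_of_finLen he hN₁
    (s.rangeRestrict ∘ₗ p) (s.surjective_rangeRestrict.comp hp)) _ ?_
  rw [← extPre_comp]
  exact h0

lemma CanonicalLike.subsingleton_of_smul (hY : CanonicalLike R Y e) [Module.Finite R N]
    {x : R} (hx : x ∈ IsLocalRing.maximalIdeal R) {g : N →ₗ[R] N'}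
    (h : IsSES (x • LinearMap.id : N →ₗ[R] N) g) (j : ℕ)
    (hN' : Subsingleton (Abelian.Ext (ModuleCat.of R N') Y (j + 1))) :
    Subsingleton (Abelian.Ext (ModuleCat.of R N) Y j) := by
  have := hY.finite
  have hfin : Module.Finite R (Abelian.Ext (ModuleCat.of R N) Y j) := inferInstance
  have hsurj := h.extPre_surjective Y j hN'
  have : (⊤ : Submodule R (Abelian.Ext (ModuleCat.of R N) Y j)) = ⊥ := by
    refine Submodule.eq_bot_of_le_smul_of_le_jacobson_bot (IsLocalRing.maximalIdeal R) ⊤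
      hfin.1 (fun z _ => ?_) (IsLocalRing.jacobson_eq_maximalIdeal ⊥ bot_ne_top).ge
    obtain ⟨w, rfl⟩ := hsurj z
    rw [extPre_smul, extPre_id]
    exact Submodule.smul_mem_smul hx trivial
  exact (Submodule.subsingleton_iff R).1 (subsingleton_of_bot_eq_top this.symm)

end ExtComparison

set_option linter.unusedSectionVars false

namespace MonomialQuotient

open ExtComparison CategoryTheory.Abelian

variable {𝕜 : Type} [Field 𝕜] {σ : Type}

/-- The ideal of power series supported in an upper set of exponents. -/
def supportIdeal (𝕜 : Type) [Field 𝕜] (U : UpperSet (σ →₀ ℕ)) : Ideal (MvPowerSeries σ 𝕜) where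
  carrier := {f | ∀ e ∉ U, coeff e f = 0}
  add_mem' {f g} hf hg e he := by rw [map_add, hf e he, hg e he, add_zero]
  zero_mem' e _ := map_zero _
  smul_mem' c f hf e he := by
    classical
    rw [smul_eq_mul, coeff_mul]
    refine Finset.sum_eq_zero fun q hq => ?_
    rw [hf q.2 fun h => he (U.upper (le_add_self.trans_eq
      (Finset.HasAntidiagonal.mem_antidiagonal.1 hq)) h), mul_zero]

lemma X_mul_mem_supportIdeal {U : UpperSet (σ →₀ ℕ)} {s : σ}
    (hs : ∀ e, e + Finsupp.single s 1 ∈ U → e ∈ U) {f : MvPowerSeries σ 𝕜} :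
    X s * f ∈ supportIdeal 𝕜 U ↔ f ∈ supportIdeal 𝕜 U := by
  refine ⟨fun h e he => ?_, fun h => Ideal.mul_mem_left _ _ h⟩
  have := h (Finsupp.single s 1 + e) fun h' => he (hs e (by rwa [add_comm]))
  rwa [X, coeff_add_monomial_mul, one_mul] at this

lemma exists_sub_X_mul_mem {U V : UpperSet (σ →₀ ℕ)} {s : σ}
    (hV : ∀ e, e ∈ V ↔ e ∈ U ∨ 0 < e s) {f : MvPowerSeries σ 𝕜} (hf : f ∈ supportIdeal 𝕜 V) :
    ∃ q, f - X s * q ∈ supportIdeal 𝕜 U := by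
  classical
  obtain ⟨q, hq⟩ : ∃ q : MvPowerSeries σ 𝕜, ∀ e, coeff e q = coeff (Finsupp.single s 1 + e) f :=
    ⟨fun e => coeff (Finsupp.single s 1 + e) f, fun _ => rfl⟩
  refine ⟨q, fun e he => ?_⟩
  rw [map_sub, X, coeff_monomial_mul]
  split_ifs with h
  · rw [one_mul, hq, add_tsub_cancel_of_le h, sub_self]
  · rw [sub_zero]
    refine hf e fun h' => ?_
    rcases (hV e).1 h' with h' | h'
    · exact he h'
    · exact h (Finsupp.single_le_iff.2 h')

lemma supportIdeal_mono {U V : UpperSet (σ →₀ ℕ)} (h : ∀ e, e ∈ U → e ∈ V) :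
    supportIdeal 𝕜 U ≤ supportIdeal 𝕜 V := fun _ hf e he => hf e fun h' => he (h e h')

variable {ι κ : Type} [Fintype ι] [Fintype κ] [DecidableEq ι]

/-- The degree in the first set of variables. -/
def xdeg (e : ι ⊕ κ →₀ ℕ) : ℕ := ∑ i, e (Sum.inl i)

/-- The degree in the second set of variables. -/
def adeg (e : ι ⊕ κ →₀ ℕ) : ℕ := ∑ j, e (Sum.inr j)

lemma adeg_mono {e e' : ι ⊕ κ →₀ ℕ} (h : e ≤ e') : adeg e ≤ adeg e' :=
  Finset.sum_le_sum fun _ _ => h _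

lemma adeg_add (e e' : ι ⊕ κ →₀ ℕ) : adeg (e + e') = adeg e + adeg e' := by
  simp [adeg, Finset.sum_add_distrib]

lemma xdeg_add (e e' : ι ⊕ κ →₀ ℕ) : xdeg (e + e') = xdeg e + xdeg e' := by
  simp [xdeg, Finset.sum_add_distrib]

/-- Exponents of degree at least `t` in the second set of variables, or involving a variable
of the first set indexed by `T`. -/
def expSet (κ : Type) [Fintype κ] (t : ℕ) (T : Finset ι) : UpperSet (ι ⊕ κ →₀ ℕ) where
  carrier := {e | t ≤ adeg e ∨ ∃ i ∈ T, 0 < e (Sum.inl i)}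
  upper' e e' h := by
    rintro (h' | ⟨i, hi, h'⟩)
    · exact Or.inl (h'.trans (adeg_mono h))
    · exact Or.inr ⟨i, hi, h'.trans_le (h _)⟩

lemma mem_expSet {t : ℕ} {T : Finset ι} {e : ι ⊕ κ →₀ ℕ} :
    e ∈ expSet κ t T ↔ t ≤ adeg e ∨ ∃ i ∈ T, 0 < e (Sum.inl i) := Iff.rfl

/-- The monomial ideal of power series supported in `expSet κ t T`. -/
def monIdeal (𝕜 : Type) [Field 𝕜] (κ : Type) [Fintype κ] (t : ℕ) (T : Finset ι) :
    Ideal (MvPowerSeries (ι ⊕ κ) 𝕜) := supportIdeal 𝕜 (expSet κ t T)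

/-- The quotient ring by a monomial ideal. -/
abbrev MonQuot (𝕜 : Type) [Field 𝕜] (κ : Type) [Fintype κ] (t : ℕ) (T : Finset ι) :=
  MvPowerSeries (ι ⊕ κ) 𝕜 ⧸ monIdeal 𝕜 κ t T

lemma monIdeal_anti {t t' : ℕ} (h : t ≤ t') (T : Finset ι) :
    monIdeal 𝕜 κ t' T ≤ monIdeal 𝕜 κ t T :=
  supportIdeal_mono fun _ he => he.imp_left h.trans

lemma monIdeal_mono (t : ℕ) {T T' : Finset ι} (h : T ⊆ T') :
    monIdeal 𝕜 κ t T ≤ monIdeal 𝕜 κ t T' :=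
  supportIdeal_mono fun _ he => he.imp_right fun ⟨i, hi, h'⟩ => ⟨i, h hi, h'⟩

lemma X_mul_mem_monIdeal {t : ℕ} {T : Finset ι} {i : ι} (hi : i ∉ T)
    {f : MvPowerSeries (ι ⊕ κ) 𝕜} :
    X (Sum.inl i) * f ∈ monIdeal 𝕜 κ t T ↔ f ∈ monIdeal 𝕜 κ t T := by
  refine X_mul_mem_supportIdeal fun e => ?_
  rintro (h | ⟨k, hk, h⟩)
  · left
    rw [adeg_add] at h
    simpa [adeg, Finsupp.single_apply] using h
  · refine Or.inr ⟨k, hk, ?_⟩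
    have : i ≠ k := fun h' => hi (h' ▸ hk)
    simpa [Finsupp.single_apply, this] using h

lemma exists_sub_X_mul_mem_monIdeal {t : ℕ} {T : Finset ι} {i : ι}
    {f : MvPowerSeries (ι ⊕ κ) 𝕜} (hf : f ∈ monIdeal 𝕜 κ t (insert i T)) :
    ∃ q, f - X (Sum.inl i) * q ∈ monIdeal 𝕜 κ t T := by
  refine exists_sub_X_mul_mem (fun e => ?_) hf
  simp only [mem_expSet, Finset.mem_insert, exists_eq_or_imp, or_assoc]
  exact or_congr_right or_comm

lemma X_mem_monIdeal {t : ℕ} {T : Finset ι} {i : ι} (hi : i ∈ T) :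
    (X (Sum.inl i) : MvPowerSeries (ι ⊕ κ) 𝕜) ∈ monIdeal 𝕜 κ t T := by
  classical
  intro e he
  rw [coeff_X, if_neg]
  rintro rfl
  exact he (Or.inr ⟨i, hi, by simp⟩)

variable {R : Type} [CommRing R] [Algebra R (MvPowerSeries (ι ⊕ κ) 𝕜)]

/-- The projection between monomial quotients. -/
def proj (R : Type) [CommRing R] [Algebra R (MvPowerSeries (ι ⊕ κ) 𝕜)] {t t' : ℕ}
    {T T' : Finset ι} (h : monIdeal 𝕜 κ t' T' ≤ monIdeal 𝕜 κ t T) :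
    MonQuot 𝕜 κ t' T' →ₗ[R] MonQuot 𝕜 κ t T :=
  (Ideal.Quotient.factorₐ R h).toLinearMap

lemma proj_mk {t t' : ℕ} {T T' : Finset ι} (h : monIdeal 𝕜 κ t' T' ≤ monIdeal 𝕜 κ t T)
    (f : MvPowerSeries (ι ⊕ κ) 𝕜) :
    proj R h (Ideal.Quotient.mk _ f) = Ideal.Quotient.mk _ f := rfl

lemma proj_surjective {t t' : ℕ} {T T' : Finset ι}
    (h : monIdeal 𝕜 κ t' T' ≤ monIdeal 𝕜 κ t T) : Function.Surjective (proj R h) :=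
  Ideal.Quotient.factor_surjective h

/-- Multiplication by a power series on a monomial quotient. -/
def mulMap (R : Type) [CommRing R] [Algebra R (MvPowerSeries (ι ⊕ κ) 𝕜)]
    (t : ℕ) (T : Finset ι) (s : MvPowerSeries (ι ⊕ κ) 𝕜) :
    MonQuot 𝕜 κ t T →ₗ[R] MonQuot 𝕜 κ t T :=
  LinearMap.mulLeft R (Ideal.Quotient.mk _ s)

lemma mulMap_mk (t : ℕ) (T : Finset ι) (s f : MvPowerSeries (ι ⊕ κ) 𝕜) :
    mulMap R t T s (Ideal.Quotient.mk _ f) = Ideal.Quotient.mk _ (s * f) := rfl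

lemma smul_mk (t : ℕ) (T : Finset ι) (r : R) (f : MvPowerSeries (ι ⊕ κ) 𝕜) :
    r • (Ideal.Quotient.mk (monIdeal 𝕜 κ t T) f) =
      Ideal.Quotient.mk _ (algebraMap R _ r * f) := by
  rw [← Algebra.smul_def]
  rfl

lemma isSES_smul (t : ℕ) {T : Finset ι} {i : ι} (hi : i ∉ T) {x : R}
    (hx : algebraMap R (MvPowerSeries (ι ⊕ κ) 𝕜) x = X (Sum.inl i)) :
    IsSES (x • LinearMap.id : MonQuot 𝕜 κ t T →ₗ[R] MonQuot 𝕜 κ t T)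
      (proj R (monIdeal_mono t (Finset.subset_insert i T))) where
  inj := by
    rw [injective_iff_map_eq_zero]
    intro f hf
    obtain ⟨f, rfl⟩ := Ideal.Quotient.mk_surjective f
    rw [LinearMap.smul_apply, LinearMap.id_apply, smul_mk, hx, Ideal.Quotient.eq_zero_iff_mem,
      X_mul_mem_monIdeal hi] at hf
    exact Ideal.Quotient.eq_zero_iff_mem.2 hf
  surj := proj_surjective _
  exact f := by
    obtain ⟨f, rfl⟩ := Ideal.Quotient.mk_surjective f
    rw [proj_mk, Ideal.Quotient.eq_zero_iff_mem]
    constructor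
    · intro hf
      obtain ⟨q, hq⟩ := exists_sub_X_mul_mem_monIdeal hf
      refine ⟨Ideal.Quotient.mk _ q, ?_⟩
      rw [LinearMap.smul_apply, LinearMap.id_apply, smul_mk, hx, eq_comm,
        Ideal.Quotient.mk_eq_mk_iff_sub_mem]
      exact hq
    · rintro ⟨q, hq⟩
      obtain ⟨q, rfl⟩ := Ideal.Quotient.mk_surjective q
      rw [LinearMap.smul_apply, LinearMap.id_apply, smul_mk, hx, eq_comm,
        Ideal.Quotient.mk_eq_mk_iff_sub_mem] at hq
      have h1 := monIdeal_mono t (Finset.subset_insert i T) hq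
      have h2 : X (Sum.inl i) * q ∈ monIdeal 𝕜 κ t (insert i T) :=
        Ideal.mul_mem_right _ _ (X_mem_monIdeal (Finset.mem_insert_self i T))
      simpa using add_mem h1 h2

section Ext

variable [IsLocalRing R] [IsNoetherianRing R] {Y : ModuleCat.{0} R} {e : ℕ}
  (hY : CanonicalLike R Y e)
  (x : ι → R) (hx : ∀ i, algebraMap R (MvPowerSeries (ι ⊕ κ) 𝕜) (x i) = X (Sum.inl i))
  (hxm : ∀ i, x i ∈ IsLocalRing.maximalIdeal R)
  (hfin : ∀ t, Module.Finite R (MonQuot 𝕜 κ t (∅ : Finset ι)))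
  (hlen : ∀ t, FinLen R (MonQuot 𝕜 κ t (Finset.univ : Finset ι)))

include hY hx hxm hfin hlen

lemma subsingleton_ext (t k : ℕ) (T : Finset ι) (hT : Tᶜ.card = k) (j : ℕ) (hj : 1 ≤ j)
    (hjk : j + k ≠ e + 1) :
    Subsingleton (Abelian.Ext (ModuleCat.of R (MonQuot 𝕜 κ t T)) Y j) := by
  induction k generalizing T j with
  | zero =>
    obtain rfl : T = Finset.univ := by simpa [Finset.card_eq_zero] using hT
    exact hY.subsingleton_of_finLen (hlen t) j hj hjk
  | succ k ih =>
    obtain ⟨i, hi⟩ : Tᶜ.Nonempty := Finset.card_pos.1 (by omega)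
    rw [Finset.mem_compl] at hi
    have := hfin t
    have : Module.Finite R (MonQuot 𝕜 κ t T) :=
      Module.Finite.of_surjective _ (proj_surjective (R := R)
        (monIdeal_mono (𝕜 := 𝕜) (κ := κ) t (Finset.empty_subset T)))
    refine hY.subsingleton_of_smul (hxm i) (isSES_smul t hi (hx i)) j
      (ih _ ?_ (j + 1) (by omega) (by omega))
    rw [Finset.compl_insert, Finset.card_erase_of_mem (by simpa using hi), hT]
    rfl

lemma exists_ext_ne_zero (he : 1 ≤ e) (t : ℕ) (s : MvPowerSeries (ι ⊕ κ) 𝕜)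
    (hs : s ∉ monIdeal 𝕜 κ t (Finset.univ : Finset ι))
    (k : ℕ) (T : Finset ι) (hT : Tᶜ.card = k) (j : ℕ) (hj : 1 ≤ j) (hjk : j + k = e + 1) :
    ∃ z : Abelian.Ext (ModuleCat.of R (MonQuot 𝕜 κ t T)) Y j, ∀ t' (h : t ≤ t'),
      extPre Y (mulMap R t T s ∘ₗ proj R (monIdeal_anti h T)) j z ≠ 0 := by
  induction k generalizing T j with
  | zero =>
    obtain rfl : T = Finset.univ := by simpa [Finset.card_eq_zero] using hT
    obtain rfl : j = e + 1 := hjk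
    obtain ⟨w, hw⟩ := hY.exists_extPre_ne_zero he (hlen t) (mulMap R t Finset.univ s) (by
      intro h0
      have := LinearMap.congr_fun h0 (Ideal.Quotient.mk _ 1)
      rw [mulMap_mk, mul_one, LinearMap.zero_apply, Ideal.Quotient.eq_zero_iff_mem] at this
      exact hs this)
    exact ⟨w, fun t' h => hw _ (hlen t') _ (proj_surjective _)⟩
  | succ k ih =>
    obtain ⟨i, hi⟩ : Tᶜ.Nonempty := Finset.card_pos.1 (by omega)
    rw [Finset.mem_compl] at hi
    have hT' : (insert i T)ᶜ.card = k := by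
      rw [Finset.compl_insert, Finset.card_erase_of_mem (by simpa using hi), hT]
      rfl
    obtain ⟨z, hz⟩ := ih _ hT' (j + 1) (by omega) (by omega)
    obtain ⟨w, rfl⟩ := (isSES_smul t hi (hx i)).δ_surjective Y j
      (subsingleton_ext hY x hx hxm hfin hlen t (k + 1) T hT (j + 1) (by omega) (by omega)) z
    refine ⟨w, fun t' h h0 => hz t' h ?_⟩
    rw [← (isSES_smul t' hi (hx i)).δ_naturality Y (isSES_smul t hi (hx i))
      (mulMap R t T s ∘ₗ proj R (monIdeal_anti h T))
      (mulMap R t T s ∘ₗ proj R (monIdeal_anti h T)), h0, map_zero]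
    · refine LinearMap.ext fun f => ?_
      exact map_smul (mulMap R t T s ∘ₗ proj R (monIdeal_anti h T)) (x i) f
    · refine LinearMap.ext fun f => ?_
      obtain ⟨f, rfl⟩ := Ideal.Quotient.mk_surjective f
      rfl

end Ext

end MonomialQuotient

namespace MonomialQuotient

open ExtComparison CategoryTheory.Abelian

variable {𝕜 : Type} [Field 𝕜] {ι κ : Type} [Fintype ι] [Fintype κ] [DecidableEq ι]
  {R : Type} [CommRing R] [Algebra R (MvPowerSeries (ι ⊕ κ) 𝕜)]

lemma mulMap_algebraMap (t : ℕ) (T : Finset ι) (r : R) :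
    mulMap R t T (algebraMap R (MvPowerSeries (ι ⊕ κ) 𝕜) r) = r • LinearMap.id := by
  refine LinearMap.ext fun f => ?_
  obtain ⟨f, rfl⟩ := Ideal.Quotient.mk_surjective f
  rw [mulMap_mk, LinearMap.smul_apply, LinearMap.id_apply, smul_mk]

lemma mulMap_add (t : ℕ) (T : Finset ι) (s s' : MvPowerSeries (ι ⊕ κ) 𝕜) :
    mulMap R t T (s + s') = mulMap R t T s + mulMap R t T s' := by
  refine LinearMap.ext fun f => ?_
  obtain ⟨f, rfl⟩ := Ideal.Quotient.mk_surjective f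
  rw [LinearMap.add_apply, mulMap_mk, mulMap_mk, mulMap_mk, add_mul, map_add]

lemma mulMap_mul (t : ℕ) (T : Finset ι) (s s' : MvPowerSeries (ι ⊕ κ) 𝕜) :
    mulMap R t T (s * s') = mulMap R t T s ∘ₗ mulMap R t T s' := by
  refine LinearMap.ext fun f => ?_
  obtain ⟨f, rfl⟩ := Ideal.Quotient.mk_surjective f
  rw [LinearMap.comp_apply, mulMap_mk, mulMap_mk, mulMap_mk, mul_assoc]

/-- The map from the quotient by a power of an ideal to a monomial quotient. -/
def powQuotMap {J : Ideal R} {t : ℕ}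
    (hJ : ∀ r, algebraMap R (MvPowerSeries (ι ⊕ κ) 𝕜) r ∈ monIdeal 𝕜 κ t (∅ : Finset ι) ↔
      r ∈ J ^ t) :
    (R ⧸ J ^ t) →ₗ[R] MonQuot 𝕜 κ t (∅ : Finset ι) :=
  Submodule.liftQ (J ^ t) (Algebra.linearMap R (MonQuot 𝕜 κ t (∅ : Finset ι)))
    fun r hr => Ideal.Quotient.eq_zero_iff_mem.2 ((hJ r).2 hr)

section

variable {J : Ideal R}
    (hJ : ∀ t r, algebraMap R (MvPowerSeries (ι ⊕ κ) 𝕜) r ∈ monIdeal 𝕜 κ t (∅ : Finset ι) ↔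
      r ∈ J ^ t)

lemma powQuotMap_mk (t : ℕ) (r : R) : powQuotMap (hJ t) (Ideal.Quotient.mk _ r) =
    Ideal.Quotient.mk _ (algebraMap R (MvPowerSeries (ι ⊕ κ) 𝕜) r) := rfl

lemma powQuotMap_injective (t : ℕ) : Function.Injective (powQuotMap (hJ t)) := by
  rw [injective_iff_map_eq_zero]
  intro r hr
  obtain ⟨r, rfl⟩ := Ideal.Quotient.mk_surjective r
  rw [powQuotMap_mk, Ideal.Quotient.eq_zero_iff_mem, hJ] at hr
  exact Ideal.Quotient.eq_zero_iff_mem.2 hr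

lemma powQuotMap_powTrans {t t' : ℕ} (h : t ≤ t') :
    powQuotMap (hJ t) ∘ₗ powTrans J h = proj R (monIdeal_anti h ∅) ∘ₗ powQuotMap (hJ t') := by
  refine LinearMap.ext fun r => ?_
  obtain ⟨r, rfl⟩ := Ideal.Quotient.mk_surjective r
  rfl

variable [IsLocalRing R] [IsNoetherianRing R]
  (hcoker : ∀ t, ∀ r ∈ IsLocalRing.maximalIdeal R ^ t, ∀ g : MvPowerSeries (ι ⊕ κ) 𝕜,
    ∃ r', algebraMap R _ r * g - algebraMap R _ r' ∈ monIdeal 𝕜 κ t (∅ : Finset ι))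

include hcoker in
lemma smul_mem_range_powQuotMap (t : ℕ) {r : R} (hr : r ∈ IsLocalRing.maximalIdeal R ^ t) (g) :
    r • g ∈ LinearMap.range (powQuotMap (hJ t)) := by
  obtain ⟨g, rfl⟩ := Ideal.Quotient.mk_surjective g
  obtain ⟨r', hr'⟩ := hcoker t r hr g
  refine ⟨Ideal.Quotient.mk _ r', ?_⟩
  rw [powQuotMap_mk, smul_mk, eq_comm, Ideal.Quotient.mk_eq_mk_iff_sub_mem]
  exact hr'

include hJ hcoker in
lemma finite_monQuot {i : ι} {x : R} (hxm : x ∈ IsLocalRing.maximalIdeal R)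
    (hx : algebraMap R (MvPowerSeries (ι ⊕ κ) 𝕜) x = X (Sum.inl i)) (t : ℕ) :
    Module.Finite R (MonQuot 𝕜 κ t (∅ : Finset ι)) := by
  have hinj : ∀ k : ℕ, Function.Injective
      (x ^ k • LinearMap.id : MonQuot 𝕜 κ t (∅ : Finset ι) →ₗ[R] _) := by
    intro k
    induction k with
    | zero => simpa using Function.injective_id
    | succ k ih =>
      intro u v huv
      have huv' : x ^ k • x • u = x ^ k • x • v := by simpa [pow_succ, mul_smul] using huv
      exact (isSES_smul t (Finset.notMem_empty i) hx).inj (ih huv')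
  have := Module.Finite.range (powQuotMap (hJ t))
  refine Module.Finite.of_injective (LinearMap.codRestrict (LinearMap.range (powQuotMap (hJ t)))
    (x ^ t • LinearMap.id : MonQuot 𝕜 κ t (∅ : Finset ι) →ₗ[R] _)
    fun g => smul_mem_range_powQuotMap hJ hcoker t (Ideal.pow_mem_pow hxm t) g) fun u v huv => ?_
  exact hinj t congr($(huv).1)

variable {Y : ModuleCat.{0} R} {e : ℕ}

include hcoker in
lemma extPre_powQuotMap_bijective (hY : CanonicalLike R Y e)
    (hfin : ∀ t, Module.Finite R (MonQuot 𝕜 κ t (∅ : Finset ι))) (t j : ℕ) (hj : 1 ≤ j)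
    (hje : j + 1 ≤ e) : Function.Bijective (extPre Y (powQuotMap (hJ t)) j) := by
  have := hfin t
  have hQ : FinLen R (MonQuot 𝕜 κ t (∅ : Finset ι) ⧸ LinearMap.range (powQuotMap (hJ t))) := by
    refine ⟨inferInstance, t, fun r hr g => ?_⟩
    obtain ⟨g, rfl⟩ := Submodule.mkQ_surjective _ g
    rw [← map_smul, Submodule.mkQ_apply, Submodule.Quotient.mk_eq_zero]
    exact smul_mem_range_powQuotMap hJ hcoker t hr g
  have h := IsSES.of_injective (powQuotMap_injective hJ t)
  exact ⟨h.extPre_left_injective Y j (hY.subsingleton_of_finLen hQ j hj (by omega)),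
    h.extPre_surjective Y j (hY.subsingleton_of_finLen hQ _ (by omega) (by omega))⟩

include hcoker in
/-- Multiplication by a power series on the monomial quotients induces an endomorphism of local
cohomology. -/
lemma exists_end (hY : CanonicalLike R Y e)
    (hfin : ∀ t, Module.Finite R (MonQuot 𝕜 κ t (∅ : Finset ι))) (p : ℕ) (hp : p + 2 ≤ e)
    (a : MvPowerSeries (ι ⊕ κ) 𝕜) :
    ∃ B : Module.End R ((localCohomology J (p + 1)).obj Y), ∀ t z,
      B (lcι J Y p t (extPre Y (powQuotMap (hJ t)) (p + 1) z)) =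
        lcι J Y p t (extPre Y (powQuotMap (hJ t)) (p + 1)
          (extPre Y (mulMap R t ∅ a) (p + 1) z)) := by
  have hbij t := extPre_powQuotMap_bijective hJ hcoker hY hfin t (p + 1) (by omega) (by omega)
  obtain ⟨B, hB⟩ := exists_end_of_compatible J Y p
    (fun t => extPre Y (powQuotMap (hJ t)) (p + 1) ∘ₗ extPre Y (mulMap R t ∅ a) (p + 1) ∘ₗ
      (LinearEquiv.ofBijective _ (hbij t)).symm.toLinearMap) (by
    intro t t' h z
    obtain ⟨z, rfl⟩ := (hbij t).2 z
    have h1 : extPre Y (powTrans J h) (p + 1) (extPre Y (powQuotMap (hJ t)) (p + 1) z) =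
        extPre Y (powQuotMap (hJ t')) (p + 1) (extPre Y (proj R (monIdeal_anti h ∅)) (p + 1) z) := by
      rw [← extPre_comp, ← extPre_comp, powQuotMap_powTrans]
    have h2 (t) (z) : (LinearEquiv.ofBijective _ (hbij t)).symm
        (extPre Y (powQuotMap (hJ t)) (p + 1) z) = z :=
      (LinearEquiv.ofBijective _ (hbij t)).symm_apply_apply z
    simp only [LinearMap.comp_apply, LinearEquiv.coe_coe]
    rw [h1, h2, h2]
    simp only [← extPre_comp]
    congr 2
    refine LinearMap.ext fun f => ?_
    obtain ⟨f, rfl⟩ := Ideal.Quotient.mk_surjective f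
    rfl)
  refine ⟨B, fun t z => ?_⟩
  rw [hB]
  simp only [LinearMap.comp_apply, LinearEquiv.coe_coe]
  congr 3
  exact (LinearEquiv.ofBijective _ (hbij t)).symm_apply_apply z

end

lemma aeval_notMem_monIdeal {j₀ : κ}
    (hcoef : ∀ (r : R) (k : ℕ),
      coeff (Finsupp.single (Sum.inr j₀) (k + 1)) (algebraMap R (MvPowerSeries (ι ⊕ κ) 𝕜) r) = 0)
    {f : Polynomial R} (hf : f.Monic) :
    Polynomial.aeval (X (Sum.inr j₀) : MvPowerSeries (ι ⊕ κ) 𝕜) f ∉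
      monIdeal 𝕜 κ (f.natDegree + 1) (Finset.univ : Finset ι) := by
  classical
  intro h
  have h1 := h (Finsupp.single (Sum.inr j₀) f.natDegree) (by
    rintro (h | ⟨i, -, h⟩)
    · simp [adeg, Finsupp.single_apply] at h
    · simp at h)
  rw [Polynomial.aeval_eq_sum_range, map_sum, Finset.sum_eq_single f.natDegree] at h1
  · rw [hf.coeff_natDegree, one_smul, X_pow_eq, coeff_monomial, if_pos rfl] at h1
    exact one_ne_zero h1
  · intro k hk hkN
    have hk : k < f.natDegree := by
      rw [Finset.mem_range] at hk
      omega
    obtain ⟨l, hl⟩ := Nat.exists_eq_add_of_lt hk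
    rw [hl, Algebra.smul_def, X_pow_eq, add_assoc, add_comm k, Finsupp.single_add,
      coeff_add_mul_monomial, hcoef, zero_mul]
  · simp

variable [IsLocalRing R] [IsNoetherianRing R] {Y : ModuleCat.{0} R} {e : ℕ} {J : Ideal R}

theorem not_finite_end [Nonempty ι]
    (hJ : ∀ t r, algebraMap R (MvPowerSeries (ι ⊕ κ) 𝕜) r ∈ monIdeal 𝕜 κ t (∅ : Finset ι) ↔
      r ∈ J ^ t)
    (hcoker : ∀ t, ∀ r ∈ IsLocalRing.maximalIdeal R ^ t, ∀ g : MvPowerSeries (ι ⊕ κ) 𝕜,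
      ∃ r', algebraMap R _ r * g - algebraMap R _ r' ∈ monIdeal 𝕜 κ t (∅ : Finset ι))
    (hmax : ∀ t, ∀ r ∈ IsLocalRing.maximalIdeal R,
      algebraMap R (MvPowerSeries (ι ⊕ κ) 𝕜) r ∈ monIdeal 𝕜 κ t (Finset.univ : Finset ι))
    (x : ι → R) (hx : ∀ i, algebraMap R (MvPowerSeries (ι ⊕ κ) 𝕜) (x i) = X (Sum.inl i))
    (hxm : ∀ i, x i ∈ IsLocalRing.maximalIdeal R) {j₀ : κ}
    (hcoef : ∀ (r : R) (k : ℕ),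
      coeff (Finsupp.single (Sum.inr j₀) (k + 1)) (algebraMap R (MvPowerSeries (ι ⊕ κ) 𝕜) r) = 0)
    (hY : CanonicalLike R Y e) (p : ℕ) (hp : p + 2 ≤ e) (hpe : p + 1 + Fintype.card ι = e + 1) :
    ¬ Module.Finite R (Module.End R ((localCohomology J (p + 1)).obj Y)) := by
  intro hE
  have hfin : ∀ t, Module.Finite R (MonQuot 𝕜 κ t (∅ : Finset ι)) :=
    finite_monQuot hJ hcoker (hxm (Classical.arbitrary ι)) (hx _)
  have hlen : ∀ t, FinLen R (MonQuot 𝕜 κ t (Finset.univ : Finset ι)) := by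
    intro t
    have := hfin t
    refine ⟨Module.Finite.of_surjective _ (proj_surjective (R := R)
      (monIdeal_mono (𝕜 := 𝕜) (κ := κ) t (Finset.empty_subset _))), 1, fun r hr g => ?_⟩
    obtain ⟨g, rfl⟩ := Ideal.Quotient.mk_surjective g
    rw [smul_mk, Ideal.Quotient.eq_zero_iff_mem]
    exact Ideal.mul_mem_right _ _ (hmax t r (by simpa using hr))
  obtain ⟨B, hB⟩ := exists_end hJ hcoker hY hfin p hp (X (Sum.inr j₀))
  obtain ⟨f, hf, hfB⟩ := IsIntegral.of_finite R B
  have key : ∀ (q : Polynomial R) t z,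
      Polynomial.aeval B q (lcι J Y p t (extPre Y (powQuotMap (hJ t)) (p + 1) z)) =
        lcι J Y p t (extPre Y (powQuotMap (hJ t)) (p + 1)
          (extPre Y (mulMap R t ∅ (Polynomial.aeval (X (Sum.inr j₀)) q)) (p + 1) z)) := by
    intro q t
    induction q using Polynomial.induction_on with
    | C r =>
      intro z
      rw [Polynomial.aeval_C, Polynomial.aeval_C, mulMap_algebraMap, extPre_smul, extPre_id,
        map_smul, map_smul, Module.algebraMap_end_apply]
    | add q q' h h' =>
      intro z
      rw [map_add, map_add, mulMap_add, extPre_add, map_add, map_add, LinearMap.add_apply, h, h']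
    | monomial k r h =>
      intro z
      rw [pow_succ, ← mul_assoc, map_mul (Polynomial.aeval B) _ Polynomial.X,
        map_mul (Polynomial.aeval _) _ Polynomial.X, Polynomial.aeval_X, Polynomial.aeval_X,
        Module.End.mul_apply, hB, h, ← extPre_comp Y _ _ _ z, ← mulMap_mul, mul_comm]
  obtain ⟨z, hz⟩ := exists_ext_ne_zero hY x hx hxm hfin hlen (by omega) (f.natDegree + 1) _
    (aeval_notMem_monIdeal hcoef hf) (Fintype.card ι) ∅ (by simp) (p + 1) (by omega) hpe
  have h0 := key f (f.natDegree + 1) z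
  rw [show Polynomial.aeval B f = 0 from hfB, LinearMap.zero_apply] at h0
  obtain ⟨t', ht', h1⟩ := exists_extPre_eq_zero J Y p _ h0.symm
  refine hz t' ht' ((extPre_powQuotMap_bijective hJ hcoker hY hfin t' (p + 1) (by omega)
    (by omega)).1 ?_)
  rw [map_zero, ← h1]
  simp only [← extPre_comp]
  congr 2
  refine LinearMap.ext fun r => ?_
  obtain ⟨r, rfl⟩ := Ideal.Quotient.mk_surjective r
  rfl

end MonomialQuotient

namespace MonomialQuotient

section WeightIdeal

variable {𝕜 : Type} [Field 𝕜] {σ : Type}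

/-- Exponents of weight at least `t`. -/
def weightSet (w : (σ →₀ ℕ) →+ ℕ) (t : ℕ) : UpperSet (σ →₀ ℕ) where
  carrier := {e | t ≤ w e}
  upper' e e' h ht := by
    obtain ⟨c, rfl⟩ := exists_add_of_le h
    change t ≤ w (e + c)
    rw [map_add]
    exact le_add_right ht

/-- Power series supported in weight at least `t`. -/
def weightIdeal (𝕜 : Type) [Field 𝕜] (w : (σ →₀ ℕ) →+ ℕ) (t : ℕ) : Ideal (MvPowerSeries σ 𝕜) :=
  supportIdeal 𝕜 (weightSet w t)

lemma mem_weightIdeal {w : (σ →₀ ℕ) →+ ℕ} {t : ℕ} {f : MvPowerSeries σ 𝕜} :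
    f ∈ weightIdeal 𝕜 w t ↔ ∀ e, w e < t → coeff e f = 0 :=
  forall_congr' fun e => imp_congr_left (show ¬ t ≤ w e ↔ _ from not_le)

lemma mul_mem_weightIdeal {w : (σ →₀ ℕ) →+ ℕ} {s t : ℕ} {f g : MvPowerSeries σ 𝕜}
    (hf : f ∈ weightIdeal 𝕜 w s) (hg : g ∈ weightIdeal 𝕜 w t) :
    f * g ∈ weightIdeal 𝕜 w (s + t) := by
  classical
  rw [mem_weightIdeal] at hf hg ⊢
  intro e he
  rw [coeff_mul]
  refine Finset.sum_eq_zero fun q hq => ?_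
  rw [← Finset.HasAntidiagonal.mem_antidiagonal.1 hq, map_add] at he
  rcases lt_or_ge (w q.1) s with h | h
  · rw [hf _ h, zero_mul]
  · rw [hg _ (by omega), mul_zero]

lemma weightIdeal_pow_le (w : (σ →₀ ℕ) →+ ℕ) (t : ℕ) :
    weightIdeal 𝕜 w 1 ^ t ≤ weightIdeal 𝕜 w t := by
  induction t with
  | zero => exact fun f _ => mem_weightIdeal.2 fun e he => absurd he (Nat.not_lt_zero _)
  | succ t ih =>
    rw [pow_succ, Ideal.mul_le]
    exact fun f hf g hg => mul_mem_weightIdeal (ih hf) hg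

lemma monomial_mem_weightIdeal (w : (σ →₀ ℕ) →+ ℕ) {t : ℕ} {d : σ →₀ ℕ} (h : t ≤ w d) (c : 𝕜) :
    monomial d c ∈ weightIdeal 𝕜 w t := by
  classical
  refine mem_weightIdeal.2 fun e he => ?_
  rw [coeff_monomial, if_neg]
  rintro rfl
  omega

lemma mem_span_X_pow [Finite σ] (N : ℕ) (f : MvPowerSeries σ 𝕜)
    (hf : ∀ d, d.degree < N → coeff d f = 0) :
    f ∈ Ideal.span (Set.range (X : σ → MvPowerSeries σ 𝕜)) ^ N := by
  classical
  have := Fintype.ofFinite σ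
  induction N generalizing f with
  | zero => simp
  | succ N ih =>
    suffices H : ∀ (T : Finset σ) (f : MvPowerSeries σ 𝕜),
        (∀ d, d.degree < N + 1 → coeff d f = 0) → (∀ d, (∀ i ∈ T, d i = 0) → coeff d f = 0) →
        f ∈ Ideal.span (Set.range (X : σ → MvPowerSeries σ 𝕜)) ^ (N + 1) by
      refine H Finset.univ f hf fun d hd => hf d ?_
      rw [show d = 0 from Finsupp.ext fun i => hd i (Finset.mem_univ i)]
      simp
    intro T
    induction T using Finset.induction_on with
    | empty =>
      intro f _ hf
      rw [show f = 0 from MvPowerSeries.ext fun d => hf d (by simp)]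
      exact zero_mem _
    | insert i T hi ihT =>
      intro f h1 h2
      obtain ⟨q, hq⟩ : ∃ q : MvPowerSeries σ 𝕜, ∀ e, coeff e q = coeff (Finsupp.single i 1 + e) f :=
        ⟨fun e => coeff (Finsupp.single i 1 + e) f, fun _ => rfl⟩
      have hq1 : q ∈ Ideal.span (Set.range (X : σ → MvPowerSeries σ 𝕜)) ^ N := by
        refine ih q fun d hd => ?_
        rw [hq]
        refine h1 _ ?_
        rw [map_add, Finsupp.degree_single]
        omega
      have hq2 : X i * q ∈ Ideal.span (Set.range (X : σ → MvPowerSeries σ 𝕜)) ^ (N + 1) := by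
        rw [pow_succ']
        exact Ideal.mul_mem_mul (Ideal.subset_span ⟨i, rfl⟩) hq1
      have hc : ∀ d, coeff d (f - X i * q) = if d i = 0 then coeff d f else 0 := by
        intro d
        rw [map_sub, X, coeff_monomial_mul]
        by_cases h : d i = 0
        · rw [if_pos h, if_neg, sub_zero]
          intro h'
          have := Finsupp.single_le_iff.1 h'
          omega
        · have h' : Finsupp.single i 1 ≤ d := Finsupp.single_le_iff.2 (by omega)
          rw [if_neg h, if_pos h', one_mul, hq, add_tsub_cancel_of_le h', sub_self]
      have hq3 := ihT (f - X i * q) (fun d hd => by rw [hc, h1 d hd, ite_self]) fun d hd => by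
        rw [hc]
        split_ifs with h
        · exact h2 d (by simpa [h] using hd)
        · rfl
      simpa using add_mem hq3 hq2

end WeightIdeal

end MonomialQuotient

namespace DetRing

open MonomialQuotient

variable {𝕜 : Type} [Field 𝕜] {m n : ℕ}

/-- The exponent of the image of a variable. -/
def varExp (s : Fin m × Fin n) : Fin m ⊕ Fin (n - 1) →₀ ℕ :=
  Finsupp.single (Sum.inl s.1) 1 +
    if h : (s.2 : ℕ) < n - 1 then Finsupp.single (Sum.inr ⟨s.2, h⟩) 1 else 0

/-- The exponent of the image of a monomial. -/
def θ : (Fin m × Fin n →₀ ℕ) →ₗ[ℕ] (Fin m ⊕ Fin (n - 1) →₀ ℕ) :=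
  Finsupp.linearCombination ℕ varExp

lemma θ_single (s : Fin m × Fin n) (k : ℕ) : θ (Finsupp.single s k) = k • varExp s := by
  simp [θ]

/-- The degree `xdeg` as an additive map. -/
def xdegHom : (Fin m ⊕ Fin (n - 1) →₀ ℕ) →+ ℕ := ⟨⟨xdeg, by simp [xdeg]⟩, xdeg_add⟩

/-- The degree `adeg` as an additive map. -/
def adegHom : (Fin m ⊕ Fin (n - 1) →₀ ℕ) →+ ℕ := ⟨⟨adeg, by simp [adeg]⟩, adeg_add⟩

lemma xdeg_varExp (s : Fin m × Fin n) : xdeg (varExp s) = 1 := by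
  unfold xdeg varExp
  split_ifs <;> simp [Finsupp.single_apply]

lemma adeg_varExp (s : Fin m × Fin n) :
    adeg (varExp s) = if (s.2 : ℕ) < n - 1 then 1 else 0 := by
  unfold adeg varExp
  split_ifs <;> simp [Finsupp.single_apply]

lemma xdeg_θ (d : Fin m × Fin n →₀ ℕ) : xdeg (θ d) = d.degree := by
  induction d using Finsupp.induction_linear with
  | zero => simp [xdeg]
  | add d d' h h' => rw [map_add, xdeg_add, h, h', map_add]
  | single s k =>
    rw [θ_single, Finsupp.degree_single]
    exact (map_nsmul xdegHom k (varExp s)).trans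
      (by rw [show xdegHom (varExp s) = 1 from xdeg_varExp s, smul_eq_mul, mul_one])

/-- The column sums of an exponent. -/
def colSum (j : Fin n) (d : Fin m × Fin n →₀ ℕ) : ℕ := ∑ i, d (i, j)

lemma θ_inl (d : Fin m × Fin n →₀ ℕ) (i : Fin m) : θ d (Sum.inl i) = ∑ j, d (i, j) := by
  induction d using Finsupp.induction_linear with
  | zero => simp
  | add d d' h h' => rw [map_add, Finsupp.add_apply, h, h']; simp [Finset.sum_add_distrib]
  | single s k =>
    obtain ⟨a, b⟩ := s
    rw [θ_single, varExp]
    by_cases h : a = i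
    · subst h
      split_ifs <;> simp [Finsupp.single_apply]
    · split_ifs <;> simp [h]

lemma θ_inr (d : Fin m × Fin n →₀ ℕ) (j : Fin n) (hj : (j : ℕ) < n - 1) :
    θ d (Sum.inr ⟨j, hj⟩) = colSum j d := by
  unfold colSum
  induction d using Finsupp.induction_linear with
  | zero => simp
  | add d d' h h' => rw [map_add, Finsupp.add_apply, h, h']; simp [Finset.sum_add_distrib]
  | single s k =>
    obtain ⟨a, b⟩ := s
    rw [θ_single, varExp]
    by_cases h : b = j
    · subst h
      simp [Finsupp.single_apply, hj]
    · have : (b : ℕ) ≠ j := fun h' => h (Fin.ext h')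
      split_ifs <;> simp [h, this]

lemma colSum_last (d : Fin m × Fin n →₀ ℕ) (j : Fin n) (hj : ¬ (j : ℕ) < n - 1) :
    colSum j d + adeg (θ d) = xdeg (θ d) := by
  unfold colSum
  induction d using Finsupp.induction_linear with
  | zero => simp [adeg, xdeg]
  | add d d' h h' =>
    rw [map_add, adeg_add, xdeg_add, ← h, ← h']
    simp only [Finsupp.add_apply, Finset.sum_add_distrib]
    ring
  | single s k =>
    obtain ⟨a, b⟩ := s
    have h1 : adeg (k • varExp (a, b)) = k * adeg (varExp (a, b)) := map_nsmul adegHom k _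
    have h2 : xdeg (k • varExp (a, b)) = k * xdeg (varExp (a, b)) := map_nsmul xdegHom k _
    rw [θ_single, h1, h2, adeg_varExp, xdeg_varExp]
    have hb := b.2
    have hjn := j.2
    by_cases h : b = j
    · subst h
      simp [Finsupp.single_apply, hj]
    · have : (b : ℕ) ≠ j := fun h' => h (Fin.ext h')
      have : (b : ℕ) < n - 1 := by omega
      simp [h, this]

lemma colSum_eq {d d' : Fin m × Fin n →₀ ℕ} (h : θ d = θ d') (j : Fin n) :
    colSum j d = colSum j d' := by
  by_cases hj : (j : ℕ) < n - 1
  · rw [← θ_inr d j hj, h, θ_inr]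
  · have h1 := colSum_last d j hj
    have h2 := colSum_last d' j hj
    rw [h] at h1
    omega

lemma adeg_θ_le (hn : 1 ≤ n) (d : Fin m × Fin n →₀ ℕ) : adeg (θ d) ≤ xdeg (θ d) := by
  have := colSum_last d ⟨n - 1, by omega⟩ (by simp)
  omega

lemma exists_θ_eq (hn : 1 ≤ n) (e : Fin m ⊕ Fin (n - 1) →₀ ℕ) (he : adeg e ≤ xdeg e) :
    ∃ d : Fin m × Fin n →₀ ℕ, θ d = e := by
  obtain ⟨N, hN⟩ : ∃ N, xdeg e = N := ⟨_, rfl⟩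
  induction N generalizing e with
  | zero =>
    refine ⟨0, ?_⟩
    have ha : adeg e = 0 := by omega
    rw [map_zero, eq_comm]
    ext (i | j)
    · exact Finset.sum_eq_zero_iff.1 hN i (Finset.mem_univ i)
    · exact Finset.sum_eq_zero_iff.1 ha j (Finset.mem_univ j)
  | succ N ih =>
    obtain ⟨i, hi⟩ : ∃ i, e (Sum.inl i) ≠ 0 := by
      by_contra! h
      simp [xdeg, h] at hN
    have key : ∀ s : Fin m × Fin n, varExp s ≤ e →
        adeg e ≤ N + adeg (varExp s) → ∃ d : Fin m × Fin n →₀ ℕ, θ d = e := by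
      intro s hs hsN
      obtain ⟨c, rfl⟩ := exists_add_of_le hs
      rw [adeg_add] at hsN
      rw [xdeg_add, xdeg_varExp] at hN
      obtain ⟨d, rfl⟩ := ih c (by omega) (by omega)
      exact ⟨Finsupp.single s 1 + d, by rw [map_add, θ_single, one_smul]⟩
    by_cases ha : adeg e = 0
    · refine key (i, ⟨n - 1, by omega⟩) ?_ (by omega)
      rw [varExp, dif_neg (by simp), add_zero, Finsupp.single_le_iff]
      exact Nat.one_le_iff_ne_zero.2 hi
    · obtain ⟨j, hj⟩ : ∃ j, e (Sum.inr j) ≠ 0 := by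
        by_contra! h
        simp [adeg, h] at ha
      refine key (i, ⟨j, by omega⟩) ?_ ?_
      · rw [varExp, dif_pos j.2]
        rintro (k | k)
        · by_cases h : i = k
          · subst h
            simp
            omega
          · simp [h]
        · by_cases h : j = k
          · subst h
            simp
            omega
          · simp [h]
      · rw [adeg_varExp, if_pos j.2]
        omega

end DetRing

namespace DetRing

open MonomialQuotient

variable {𝕜 : Type} [Field 𝕜] {m n : ℕ}

lemma hasSubst_varExp : HasSubst fun s : Fin m × Fin n =>
    (monomial (varExp s) 1 : MvPowerSeries (Fin m ⊕ Fin (n - 1)) 𝕜) := by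
  classical
  refine hasSubst_of_constantCoeff_zero fun s => ?_
  rw [← coeff_zero_eq_constantCoeff_apply, coeff_monomial, if_neg]
  intro h
  have := xdeg_varExp s
  rw [← h] at this
  simp [xdeg] at this

variable (𝕜 m n) in
/-- The substitution of monomials. -/
def phiP : DetP 𝕜 m n →ₐ[𝕜] DetS 𝕜 m n := substAlgHom hasSubst_varExp

lemma coeff_phiP (f : DetP 𝕜 m n) (e : Fin m ⊕ Fin (n - 1) →₀ ℕ) :
    coeff e (phiP 𝕜 m n f) = ∑ᶠ d, if θ d = e then coeff d f else 0 := by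
  classical
  rw [phiP, substAlgHom_apply, coeff_subst hasSubst_varExp]
  refine finsum_congr fun d => ?_
  have : (d.prod fun s k => (monomial (varExp s) 1 : DetS 𝕜 m n) ^ k) = monomial (θ d) 1 := by
    simp only [Finsupp.prod, monomial_pow, one_pow, prod_monomial, Finset.prod_const_one]
    rfl
  rw [this, coeff_monomial]
  simp [eq_comm]

lemma coeff_phiP_eq_zero {f : DetP 𝕜 m n} {e : Fin m ⊕ Fin (n - 1) →₀ ℕ}
    (h : ∀ d, θ d = e → coeff d f = 0) : coeff e (phiP 𝕜 m n f) = 0 := by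
  rw [coeff_phiP]
  refine finsum_eq_zero_of_forall_eq_zero fun d => ?_
  split_ifs with hd
  · exact h d hd
  · rfl

lemma phiP_X (s : Fin m × Fin n) : phiP 𝕜 m n (X s) = monomial (varExp s) 1 := by
  rw [phiP, substAlgHom_X]

lemma exists_phiP_eq (hn : 1 ≤ n) (g : DetS 𝕜 m n)
    (hg : ∀ e, xdeg e < adeg e → coeff e g = 0) : ∃ f, phiP 𝕜 m n f = g := by
  classical
  choose! τ hτ using exists_θ_eq (m := m) hn
  obtain ⟨f, hf⟩ : ∃ f : DetP 𝕜 m n, ∀ d, coeff d f = if d = τ (θ d) then coeff (θ d) g else 0 :=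
    ⟨fun d => if d = τ (θ d) then coeff (θ d) g else 0, fun _ => rfl⟩
  refine ⟨f, MvPowerSeries.ext fun e => ?_⟩
  by_cases he : adeg e ≤ xdeg e
  · rw [coeff_phiP, finsum_eq_single _ (τ e), hτ e he, if_pos rfl, hf, hτ e he, if_pos rfl]
    intro d hd
    split_ifs with h
    · rw [hf, h, if_neg hd]
    · rfl
  · rw [hg e (not_le.1 he)]
    refine coeff_phiP_eq_zero fun d hd => ?_
    subst hd
    exact absurd (adeg_θ_le hn d) he

lemma detI2_le : detI2 𝕜 m n ≤ RingHom.ker (phiP 𝕜 m n) := by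
  refine Ideal.span_le.2 ?_
  rintro _ ⟨i, k, j, l, -, -, rfl⟩
  rw [SetLike.mem_coe, RingHom.mem_ker, map_sub, map_mul, map_mul, phiP_X, phiP_X, phiP_X, phiP_X,
    monomial_mul_monomial, monomial_mul_monomial, sub_eq_zero]
  congr 1
  simp only [varExp]
  congr 1
  abel

variable (𝕜 m n) in
/-- The homomorphism from the determinantal ring to the power series ring. -/
def phi : DetR 𝕜 m n →+* DetS 𝕜 m n :=
  Ideal.Quotient.lift _ (phiP 𝕜 m n : DetP 𝕜 m n →+* DetS 𝕜 m n) detI2_le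

lemma phi_mk (f : DetP 𝕜 m n) : phi 𝕜 m n (Ideal.Quotient.mk _ f) = phiP 𝕜 m n f := rfl

lemma phi_detx (i : Fin m) (j : Fin n) : phi 𝕜 m n (detx 𝕜 m n i j) = monomial (varExp (i, j)) 1 :=
  phiP_X _

lemma detx_mul_detx (i k : Fin m) (j l : Fin n) :
    detx 𝕜 m n i j * detx 𝕜 m n k l = detx 𝕜 m n i l * detx 𝕜 m n k j := by
  have key : ∀ (i k : Fin m) (j l : Fin n), i < k → j < l →
      detx 𝕜 m n i j * detx 𝕜 m n k l = detx 𝕜 m n i l * detx 𝕜 m n k j := by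
    intro i k j l h h'
    exact Ideal.Quotient.eq.2 (Ideal.subset_span ⟨i, k, j, l, h, h', rfl⟩)
  rcases lt_trichotomy i k with h | rfl | h
  · rcases lt_trichotomy j l with h' | rfl | h'
    · exact key i k j l h h'
    · rfl
    · exact (key i k l j h h').symm
  · exact mul_comm _ _
  · rcases lt_trichotomy j l with h' | rfl | h'
    · rw [mul_comm, ← key k i j l h h', mul_comm]
    · rfl
    · rw [mul_comm, key k i l j h h', mul_comm]

variable (𝕜) in
/-- The class of a monomial in the determinantal ring. -/
def mkMon (d : Fin m × Fin n →₀ ℕ) : DetR 𝕜 m n := Ideal.Quotient.mk _ (monomial d 1)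

lemma mkMon_add (d d' : Fin m × Fin n →₀ ℕ) : mkMon 𝕜 (d + d') = mkMon 𝕜 d * mkMon 𝕜 d' := by
  rw [mkMon, mkMon, mkMon, ← map_mul, monomial_mul_monomial, one_mul]

lemma mkMon_single (i : Fin m) (j : Fin n) :
    mkMon 𝕜 (Finsupp.single (i, j) 1) = detx 𝕜 m n i j := rfl

lemma varExp_swap (i k : Fin m) (j l : Fin n) :
    varExp (i, j) + varExp (k, l) = varExp (i, l) + varExp (k, j) := by
  simp only [varExp]
  abel

lemma θ_single_add (s : Fin m × Fin n) (d) : θ (Finsupp.single s 1 + d) = varExp s + θ d := by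
  rw [map_add, θ_single, one_smul]

lemma exists_single_add {d : Fin m × Fin n →₀ ℕ} {s} (h : d s ≠ 0) :
    ∃ d', d = Finsupp.single s 1 + d' :=
  exists_add_of_le (Finsupp.single_le_iff.2 (Nat.one_le_iff_ne_zero.2 h))

lemma mkMon_eq_of_θ_eq {d d' : Fin m × Fin n →₀ ℕ} (h : θ d = θ d') : mkMon 𝕜 d = mkMon 𝕜 d' := by
  obtain ⟨N, hN⟩ : ∃ N, d.degree = N := ⟨_, rfl⟩
  have hN' : d'.degree = N := by rw [← hN, ← xdeg_θ, ← xdeg_θ, h]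
  induction N generalizing d d' with
  | zero =>
    rw [Finsupp.degree_eq_zero_iff] at hN hN'
    rw [hN, hN']
  | succ N ih =>
    have key : ∀ (s) (c c' : Fin m × Fin n →₀ ℕ), d = Finsupp.single s 1 + c →
        θ (Finsupp.single s 1 + c') = θ d' → mkMon 𝕜 d = mkMon 𝕜 (Finsupp.single s 1 + c') := by
      rintro s c c' rfl hc'
      rw [← h, θ_single_add, θ_single_add, add_right_inj] at hc'
      rw [map_add, Finsupp.degree_single] at hN
      have hc : c.degree = N := by omega
      rw [mkMon_add, mkMon_add, ih hc'.symm hc (by rw [← hc, ← xdeg_θ, ← xdeg_θ, hc'])]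
    obtain ⟨⟨i, j⟩, hij⟩ : ∃ s, d s ≠ 0 := by
      by_contra! h0
      rw [show d = 0 from Finsupp.ext h0] at hN
      simp at hN
    obtain ⟨c, hc⟩ := exists_single_add hij
    obtain ⟨l, hl⟩ : ∃ l, d' (i, l) ≠ 0 := by
      by_contra! h0
      have := θ_inl d' i
      rw [← h, θ_inl, Finset.sum_congr rfl fun l _ => h0 l, Finset.sum_const_zero,
        Finset.sum_eq_zero_iff] at this
      exact hij (this j (Finset.mem_univ j))
    obtain ⟨k, hk⟩ : ∃ k, d' (k, j) ≠ 0 := by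
      by_contra! h0
      have := colSum_eq h j
      rw [colSum, colSum, Finset.sum_congr rfl fun k _ => h0 k, Finset.sum_const_zero,
        Finset.sum_eq_zero_iff] at this
      exact hij (this i (Finset.mem_univ i))
    obtain ⟨c', hc'⟩ := exists_single_add hl
    by_cases hlj : l = j
    · subst hlj
      rw [key _ c c' hc (by rw [hc']), hc']
    · have hk' : c' (k, j) ≠ 0 := by
        rw [hc'] at hk
        simpa [hlj] using hk
      obtain ⟨c'', hc''⟩ := exists_single_add hk'
      rw [key _ c (Finsupp.single (k, l) 1 + c'') hc, hc', hc'']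
      · rw [mkMon_add, mkMon_add, mkMon_add, mkMon_add, ← mul_assoc, ← mul_assoc,
          mkMon_single, mkMon_single, mkMon_single, mkMon_single, detx_mul_detx]
      · rw [hc', hc'']
        simp only [θ_single_add]
        rw [← add_assoc, varExp_swap, add_assoc]

end DetRing

namespace DetRing

open MonomialQuotient ExtComparison

variable {𝕜 : Type} [Field 𝕜] {m n : ℕ}

lemma mem_monIdeal_empty {t : ℕ} {f : DetS 𝕜 m n} :
    f ∈ monIdeal 𝕜 (Fin (n - 1)) t (∅ : Finset (Fin m)) ↔ ∀ e, adeg e < t → coeff e f = 0 := by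
  refine forall_congr' fun e => imp_congr_left ?_
  simp [mem_expSet]

lemma mkMon_mem_detJ_pow (d : Fin m × Fin n →₀ ℕ) :
    mkMon 𝕜 d ∈ detJ 𝕜 m n ^ adeg (θ d) := by
  induction d using Finsupp.induction_linear with
  | zero => simp [adeg]
  | add d d' h h' =>
    rw [map_add, adeg_add, mkMon_add]
    exact (pow_add (detJ 𝕜 m n) _ _).ge (Ideal.mul_mem_mul h h')
  | single s k =>
    obtain ⟨i, j⟩ := s
    induction k with
    | zero => simp [adeg]
    | succ k ih =>
      rw [Finsupp.single_add, map_add, adeg_add, mkMon_add]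
      refine (pow_add (detJ 𝕜 m n) _ _).ge (Ideal.mul_mem_mul ih ?_)
      rw [θ_single, one_smul, adeg_varExp, mkMon_single]
      split_ifs with h
      · rw [pow_one]
        exact Ideal.subset_span ⟨i, j, h, rfl⟩
      · simp

lemma phi_mem_of_mem_detJ_pow (t : ℕ) (r : DetR 𝕜 m n) (hr : r ∈ detJ 𝕜 m n ^ t) :
    phi 𝕜 m n r ∈ monIdeal 𝕜 (Fin (n - 1)) t (∅ : Finset (Fin m)) := by
  have h : (detJ 𝕜 m n).map (phi 𝕜 m n) ≤ weightIdeal 𝕜 adegHom 1 := by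
    rw [detJ, Ideal.map_span, Ideal.span_le]
    rintro _ ⟨_, ⟨i, j, hj, rfl⟩, rfl⟩
    rw [phi_detx]
    refine monomial_mem_weightIdeal _ ?_ _
    exact (adeg_varExp (i, j)).trans (if_pos hj) |>.ge
  have := Ideal.mem_map_of_mem (phi 𝕜 m n) hr
  rw [Ideal.map_pow] at this
  exact mem_monIdeal_empty.2
    (mem_weightIdeal.1 (weightIdeal_pow_le _ _ (Ideal.pow_right_mono h t this)))

section Local

variable [IsLocalRing (DetR 𝕜 m n)]

open IsLocalRing

lemma detx_mem_maximalIdeal (i : Fin m) (j : Fin n) :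
    detx 𝕜 m n i j ∈ maximalIdeal (DetR 𝕜 m n) := by
  classical
  rw [mem_maximalIdeal, mem_nonunits_iff]
  intro h
  have h1 := (h.map (phi 𝕜 m n)).map (constantCoeff (σ := Fin m ⊕ Fin (n - 1)) (R := 𝕜))
  rw [phi_detx, ← coeff_zero_eq_constantCoeff_apply, coeff_monomial, if_neg] at h1
  · exact not_isUnit_zero h1
  · intro h
    have := xdeg_varExp (i, j)
    rw [← h] at this
    simp [xdeg] at this

lemma constantCoeff_eq_zero {f : DetP 𝕜 m n}
    (hf : Ideal.Quotient.mk (detI2 𝕜 m n) f ∈ maximalIdeal (DetR 𝕜 m n)) : coeff 0 f = 0 := by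
  by_contra h
  rw [mem_maximalIdeal, mem_nonunits_iff] at hf
  refine hf (IsUnit.map _ ?_)
  rw [MvPowerSeries.isUnit_iff_constantCoeff]
  exact isUnit_iff_ne_zero.2 h

lemma mk_mem_maximalIdeal_pow {N : ℕ} {f : DetP 𝕜 m n} (hf : ∀ d, d.degree < N → coeff d f = 0) :
    Ideal.Quotient.mk (detI2 𝕜 m n) f ∈ maximalIdeal (DetR 𝕜 m n) ^ N := by
  have h := Ideal.mem_map_of_mem (Ideal.Quotient.mk (detI2 𝕜 m n)) (mem_span_X_pow N f hf)
  rw [Ideal.map_pow] at h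
  refine Ideal.pow_right_mono ?_ N h
  rw [Ideal.map_span, Ideal.span_le]
  rintro _ ⟨_, ⟨⟨i, j⟩, rfl⟩, rfl⟩
  exact detx_mem_maximalIdeal i j

lemma phi_mem_of_mem_maximalIdeal (t : ℕ) (r : DetR 𝕜 m n)
    (hr : r ∈ maximalIdeal (DetR 𝕜 m n) ^ t) : phi 𝕜 m n r ∈ weightIdeal 𝕜 xdegHom t := by
  have h : (maximalIdeal (DetR 𝕜 m n)).map (phi 𝕜 m n) ≤ weightIdeal 𝕜 xdegHom 1 := by
    rw [Ideal.map_le_iff_le_comap]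
    intro r hr
    obtain ⟨f, rfl⟩ := Ideal.Quotient.mk_surjective r
    rw [Ideal.mem_comap, phi_mk, mem_weightIdeal]
    intro e he
    refine coeff_phiP_eq_zero fun d hd => ?_
    have hd' : xdeg (θ d) < 1 := by rw [hd]; exact he
    rw [xdeg_θ, Nat.lt_one_iff, Finsupp.degree_eq_zero_iff] at hd'
    rw [hd']
    exact constantCoeff_eq_zero hr
  have := Ideal.mem_map_of_mem (phi 𝕜 m n) hr
  rw [Ideal.map_pow] at this
  exact weightIdeal_pow_le _ _ (Ideal.pow_right_mono h t this)

lemma phi_mem_monIdeal_univ (t : ℕ) (r : DetR 𝕜 m n)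
    (hr : r ∈ maximalIdeal (DetR 𝕜 m n)) :
    phi 𝕜 m n r ∈ monIdeal 𝕜 (Fin (n - 1)) t (Finset.univ : Finset (Fin m)) := by
  have h := mem_weightIdeal.1 (phi_mem_of_mem_maximalIdeal 1 r (by rwa [pow_one]))
  intro e he
  refine h e (Nat.lt_one_iff.2 (show xdeg e = 0 from Finset.sum_eq_zero fun i _ => ?_))
  by_contra h'
  exact he (mem_expSet.2 (Or.inr ⟨i, Finset.mem_univ i, Nat.pos_of_ne_zero h'⟩))

lemma exists_phi_sub_mem (hn : 1 ≤ n) (t : ℕ) (r : DetR 𝕜 m n)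
    (hr : r ∈ maximalIdeal (DetR 𝕜 m n) ^ t) (g : DetS 𝕜 m n) :
    ∃ r', phi 𝕜 m n r * g - phi 𝕜 m n r' ∈ monIdeal 𝕜 (Fin (n - 1)) t (∅ : Finset (Fin m)) := by
  have h := mem_weightIdeal.1 (Ideal.mul_mem_right g _ (phi_mem_of_mem_maximalIdeal t r hr))
  obtain ⟨q, hq⟩ : ∃ q : DetS 𝕜 m n,
      ∀ e, coeff e q = if adeg e < t then coeff e (phi 𝕜 m n r * g) else 0 :=
    ⟨fun e => if adeg e < t then coeff e (phi 𝕜 m n r * g) else 0, fun _ => rfl⟩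
  obtain ⟨f, hf⟩ := exists_phiP_eq hn q fun e he => by
    rw [hq]
    split_ifs with h'
    · exact h e (show xdeg e < t by omega)
    · rfl
  refine ⟨Ideal.Quotient.mk _ f, mem_monIdeal_empty.2 fun e he => ?_⟩
  rw [phi_mk, hf, map_sub, hq, if_pos he, sub_self]

lemma exists_mem_detJ_pow_sub (t N : ℕ) (f : DetP 𝕜 m n)
    (hf : phiP 𝕜 m n f ∈ monIdeal 𝕜 (Fin (n - 1)) t (∅ : Finset (Fin m))) :
    ∃ r ∈ detJ 𝕜 m n ^ t,
      Ideal.Quotient.mk (detI2 𝕜 m n) f - r ∈ maximalIdeal (DetR 𝕜 m n) ^ N := by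
  classical
  have hF := Finsupp.finite_of_degree_le (σ := Fin m × Fin n) N
  set F := hF.toFinset with hFdef
  have hmemF : ∀ d, d ∈ F ↔ d.degree ≤ N := fun d => by simp [hFdef]
  refine ⟨Ideal.Quotient.mk _ (∑ d ∈ F, monomial d (coeff d f)), ?_, ?_⟩
  · rw [map_sum, ← Finset.sum_fiberwise_of_maps_to (fun d hd => Finset.mem_image_of_mem θ hd)]
    refine sum_mem fun e he => ?_
    obtain ⟨d₀, hd₀, rfl⟩ := Finset.mem_image.1 he
    have h1 : ∀ d, Ideal.Quotient.mk (detI2 𝕜 m n) (monomial d (coeff d f)) =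
        Ideal.Quotient.mk (detI2 𝕜 m n) (C (coeff d f)) * mkMon 𝕜 d := by
      intro d
      rw [mkMon, ← map_mul, ← monomial_zero_eq_C_apply, monomial_mul_monomial, zero_add, mul_one]
    have h2 : coeff (θ d₀) (phiP 𝕜 m n f) = ∑ d ∈ F with θ d = θ d₀, coeff d f := by
      rw [coeff_phiP, Finset.sum_filter]
      refine finsum_eq_sum_of_support_subset _ fun d hd => ?_
      have hd' : θ d = θ d₀ := by
        by_contra h
        exact hd (if_neg h)
      rw [Finset.mem_coe, hmemF, ← xdeg_θ, hd', xdeg_θ]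
      exact (hmemF _).1 hd₀
    rw [Finset.sum_congr rfl fun d hd => by
      rw [h1, mkMon_eq_of_θ_eq (Finset.mem_filter.1 hd).2], ← Finset.sum_mul, ← map_sum,
      ← map_sum, ← h2]
    by_cases h : adeg (θ d₀) < t
    · rw [mem_monIdeal_empty.1 hf _ h, map_zero, map_zero, zero_mul]
      exact zero_mem _
    · exact Ideal.mul_mem_left _ _ (Ideal.pow_le_pow_right (not_lt.1 h) (mkMon_mem_detJ_pow d₀))
  · rw [← map_sub]
    refine mk_mem_maximalIdeal_pow fun d hd => ?_
    rw [map_sub, map_sum, Finset.sum_eq_single_of_mem d ((hmemF d).2 hd.le), coeff_monomial_same,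
      sub_self]
    intro d' _ h
    rw [coeff_monomial_ne h.symm]

instance : IsNoetherianRing (DetR 𝕜 m n) := inferInstance

lemma phi_mem_iff (t : ℕ) (r : DetR 𝕜 m n) :
    phi 𝕜 m n r ∈ monIdeal 𝕜 (Fin (n - 1)) t (∅ : Finset (Fin m)) ↔ r ∈ detJ 𝕜 m n ^ t := by
  refine ⟨fun h => ?_, phi_mem_of_mem_detJ_pow t r⟩
  obtain ⟨f, rfl⟩ := Ideal.Quotient.mk_surjective r
  have hK := Ideal.iInf_pow_smul_eq_bot_of_isLocalRing (M := DetR 𝕜 m n ⧸ detJ 𝕜 m n ^ t)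
    (maximalIdeal (DetR 𝕜 m n)) (maximalIdeal.isMaximal _).ne_top
  rw [← Ideal.Quotient.eq_zero_iff_mem, ← Submodule.mem_bot (DetR 𝕜 m n), ← hK,
    Submodule.mem_iInf]
  intro N
  obtain ⟨r, hr, hr'⟩ := exists_mem_detJ_pow_sub t N f h
  have h1 : Ideal.Quotient.mk (detJ 𝕜 m n ^ t) (Ideal.Quotient.mk (detI2 𝕜 m n) f) =
      (Ideal.Quotient.mk (detI2 𝕜 m n) f - r) • (1 : DetR 𝕜 m n ⧸ detJ 𝕜 m n ^ t) := by
    change _ = Ideal.Quotient.mk (detJ 𝕜 m n ^ t) (_ * 1)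
    rw [mul_one, map_sub, Ideal.Quotient.eq_zero_iff_mem.2 hr, sub_zero]
  rw [h1]
  exact Submodule.smul_mem_smul hr' Submodule.mem_top

end Local

lemma coeff_phi_eq_zero (hn : 1 ≤ n) (j : Fin (n - 1)) (r : DetR 𝕜 m n) (k : ℕ) :
    coeff (Finsupp.single (Sum.inr j) (k + 1)) (phi 𝕜 m n r) = 0 := by
  obtain ⟨f, rfl⟩ := Ideal.Quotient.mk_surjective r
  rw [phi_mk]
  refine coeff_phiP_eq_zero fun d hd => ?_
  have := adeg_θ_le hn d
  rw [hd] at this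
  have hx : xdeg (Finsupp.single (Sum.inr j : Fin m ⊕ Fin (n - 1)) (k + 1)) = 0 := by simp [xdeg]
  have ha : adeg (Finsupp.single (Sum.inr j : Fin m ⊕ Fin (n - 1)) (k + 1)) = 0 := by omega
  exact absurd (Finset.sum_eq_zero_iff.1 ha j (Finset.mem_univ j)) (by simp)

lemma canonicalLike {R : Type} [CommRing R] [IsLocalRing R] {e : ℕ} {ω : ModuleCat R}
    (hω : IsCanonicalModule R (e + 1) ω) : CanonicalLike R ω e where
  finite := hω.1
  subsingleton j hj hje := by
    obtain ⟨p, rfl⟩ := Nat.exists_eq_add_of_le' hj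
    have := hω.2.1 (p + 1) hje
    exact (ExtComparison.comparison _ _ _).symm.toEquiv.subsingleton
  nontrivial := by
    obtain ⟨i⟩ := hω.2.2
    exact ((ExtComparison.comparison _ _ _).symm.trans i).toEquiv.nontrivial

end DetRing

/-- for any canonical module `ω_R` of `R`, the endomorphism ring
`Hom_R(H^{n-1}_I(ω_R), H^{n-1}_I(ω_R))` is not finitely generated as an `R`-module. -/
theorem statement12 [IsLocalRing (DetR 𝕜 m n)] (hm : 2 ≤ m) (hn : 2 ≤ n)
    (ω : ModuleCat (DetR 𝕜 m n)) (hω : IsCanonicalModule (DetR 𝕜 m n) (m + n - 1) ω) :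
    ¬ Module.Finite (DetR 𝕜 m n)
      (Module.End (DetR 𝕜 m n) ((localCohomology (detJ 𝕜 m n) (n - 1)).obj ω)) := by
  let _ : Algebra (DetR 𝕜 m n) (DetS 𝕜 m n) := (DetRing.phi 𝕜 m n).toAlgebra
  have : Nonempty (Fin m) := ⟨⟨0, by omega⟩⟩
  have hY : ExtComparison.CanonicalLike (DetR 𝕜 m n) ω (m + n - 2) :=
    DetRing.canonicalLike (by rwa [show m + n - 2 + 1 = m + n - 1 by omega])
  have hn1 : 1 ≤ n := by omega
  have hx : ∀ i, DetRing.phi 𝕜 m n (detx 𝕜 m n i ⟨n - 1, by omega⟩) = X (Sum.inl i) := by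
    intro i
    rw [DetRing.phi_detx, DetRing.varExp, dif_neg (by simp), add_zero]
    rfl
  have h := MonomialQuotient.not_finite_end (R := DetR 𝕜 m n) (ι := Fin m) (κ := Fin (n - 1))
    (J := detJ 𝕜 m n) DetRing.phi_mem_iff (DetRing.exists_phi_sub_mem hn1)
    DetRing.phi_mem_monIdeal_univ (fun i => detx 𝕜 m n i ⟨n - 1, by omega⟩) hx
    (fun i => DetRing.detx_mem_maximalIdeal _ _) (DetRing.coeff_phi_eq_zero hn1 ⟨0, by omega⟩)
    hY (n - 2) (by omega) (by rw [Fintype.card_fin]; omega)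
  rwa [show n - 2 + 1 = n - 1 by omega] at h
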